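/- arXiv:2405.11364 — 16 statements merged into one kernel-verified Lean document; each statement's English description precedes it below -/
import Mathlib

section
/- Let A be a ∇-algebra. Then the following are equivalent: (i) b ≤ ∇b for all b ∈ A; (ii) a ⊓ (a → b) ≤ b for all a, b ∈ A; (iii) □b ≤ b for all b ∈ A. -/
/-- (Right) In a ∇-algebra the following are equivalent:
(i) `b ≤ ∇b` for all `b`; (ii) `a ⊓ (a → b) ≤ b` for all `a, b`;
(iii) `□b ≤ b` for all `b` (where `□b = ⊤ → b`). -/
theorem nabla_right_tfae {A : Type*} [Lattice A] [BoundedOrder A]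
    (nab : A → A) (arr : A → A → A)
    (adj : ∀ a b c : A, nab c ⊓ a ≤ b ↔ c ≤ arr a b) :
    ((∀ b : A, b ≤ nab b) ↔ (∀ a b : A, a ⊓ arr a b ≤ b)) ∧
    ((∀ b : A, b ≤ nab b) ↔ (∀ b : A, arr ⊤ b ≤ b)) := by
  have hle (a b : A) : nab (arr a b) ⊓ a ≤ b := (adj a b _).2 le_rfl
  have hunit (b : A) : b ≤ arr ⊤ (nab b) := (adj ⊤ (nab b) b).1 inf_le_left
  have mp (h : ∀ b : A, b ≤ nab b) (a b : A) : a ⊓ arr a b ≤ b :=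
    (le_inf (inf_le_right.trans (h _)) inf_le_left).trans (hle a b)
  have box_le (h : ∀ a b : A, a ⊓ arr a b ≤ b) (b : A) : arr ⊤ b ≤ b :=
    (le_inf le_top le_rfl).trans (h ⊤ b)
  have le_nab (h : ∀ b : A, arr ⊤ b ≤ b) (b : A) : b ≤ nab b := (hunit b).trans (h _)
  exact ⟨⟨mp, fun h => le_nab (box_le h)⟩, ⟨fun h => box_le (mp h), le_nab⟩⟩
end

section
/- Let A be a ∇-algebra. Then the following are equivalent: (i) ∇b ≤ b for all b ∈ A; (ii) for all a, b, c ∈ A, c ⊓ a ≤ b implies c ≤ a → b; (iii) b ≤ □b for all b ∈ A. -/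
/-- (Left) In a ∇-algebra the following are equivalent:
(i) `∇b ≤ b` for all `b`; (ii) `c ⊓ a ≤ b` implies `c ≤ a → b`;
(iii) `b ≤ □b` for all `b` (where `□b = ⊤ → b`). -/
theorem nabla_left_tfae {A : Type*} [Lattice A] [BoundedOrder A]
    (nab : A → A) (arr : A → A → A)
    (adj : ∀ a b c : A, nab c ⊓ a ≤ b ↔ c ≤ arr a b) :
    ((∀ b : A, nab b ≤ b) ↔ (∀ a b c : A, c ⊓ a ≤ b → c ≤ arr a b)) ∧
    ((∀ b : A, nab b ≤ b) ↔ (∀ b : A, b ≤ arr ⊤ b)) := by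
  have box_iff (b : A) : nab b ≤ b ↔ b ≤ arr ⊤ b := by simpa using adj ⊤ b b
  refine ⟨⟨fun h a b c hc => ?_, fun h b => ?_⟩, forall_congr' box_iff⟩
  · exact (adj a b c).1 ((inf_le_inf_right a (h c)).trans hc)
  · exact (box_iff b).2 (h ⊤ b b inf_le_left)
end

section
/- Let A be a ∇-algebra. Then the following are equivalent: (i) ∇□a = a for all a ∈ A; (ii) ∇ is surjective; (iii) a ⊓ ∇(a → b) = a ⊓ b for all a, b ∈ A; (iv) for all a, b, c ∈ A, c → a ≤ c → b implies c ⊓ a ≤ b; (v) □ is an order embedding, i.e., □a ≤ □b implies a ≤ b for all a, b ∈ A. -/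
/-- (Faithfulness) In a ∇-algebra the following are equivalent:
(i) `∇□a = a`; (ii) `∇` is surjective; (iii) `a ⊓ ∇(a → b) = a ⊓ b`;
(iv) `c → a ≤ c → b` implies `c ⊓ a ≤ b`; (v) `□` is an order embedding.
Here `□a = ⊤ → a`. -/
theorem nabla_faithful_tfae {A : Type*} [Lattice A] [BoundedOrder A]
    (nab : A → A) (arr : A → A → A)
    (adj : ∀ a b c : A, nab c ⊓ a ≤ b ↔ c ≤ arr a b) :
    ((∀ a : A, nab (arr ⊤ a) = a) ↔ Function.Surjective nab) ∧
    ((∀ a : A, nab (arr ⊤ a) = a) ↔ (∀ a b : A, a ⊓ nab (arr a b) = a ⊓ b)) ∧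
    ((∀ a : A, nab (arr ⊤ a) = a) ↔
      (∀ a b c : A, arr c a ≤ arr c b → c ⊓ a ≤ b)) ∧
    ((∀ a : A, nab (arr ⊤ a) = a) ↔
      (∀ a b : A, arr ⊤ a ≤ arr ⊤ b → a ≤ b)) := by
  have gc : GaloisConnection nab (arr ⊤) := fun c b => by
    rw [← adj, inf_top_eq]
  have inf_le_nab (h : ∀ a : A, nab (arr ⊤ a) = a) (a b : A) : a ⊓ b ≤ nab (arr a b) := by
    have hb : arr ⊤ b ≤ arr a b := (adj a b _).1 (inf_le_left.trans (h b).le)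
    calc a ⊓ b ≤ b := inf_le_right
      _ = nab (arr ⊤ b) := (h b).symm
      _ ≤ nab (arr a b) := gc.monotone_l hb
  have nab_inf_le (a b : A) : nab (arr a b) ⊓ a ≤ b := (adj a b _).2 le_rfl
  refine ⟨⟨fun h a => ⟨_, h a⟩, fun h a => ?_⟩, ⟨fun h a b => ?_, fun h a => ?_⟩,
    ⟨fun h a b c hab => ?_, fun h a => ?_⟩, ⟨fun h a b hab => ?_, fun h a => ?_⟩⟩
  · obtain ⟨x, rfl⟩ := h a
    exact gc.l_u_l_eq_l x
  · exact le_antisymm (le_inf inf_le_left (inf_comm a _ ▸ nab_inf_le a b))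
      (le_inf inf_le_left (inf_le_nab h a b))
  · simpa using h ⊤ a
  · exact (le_inf (inf_le_nab h c a) inf_le_left).trans ((adj c b _).2 hab)
  · refine le_antisymm (gc.l_u_le a) ?_
    simpa using h a (nab (arr ⊤ a)) ⊤ (gc.le_u_l _)
  · rw [← h a]
    exact gc.l_le hab
  · exact le_antisymm (gc.l_u_le a) (h _ _ (gc.le_u_l _))
end

section
/- Let A be a faithful ∇-algebra (i.e., ∇ is surjective). Then the operation a ⊃ b := ∇(a → b) is a Heyting implication on A, i.e., for all a, b, c ∈ A: c ⊓ a ≤ b if and only if c ≤ ∇(a → b). Consequently, the underlying lattice of A is distributive. -/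
/-- In a faithful ∇-algebra (∇ surjective), `a ⊃ b := ∇(a → b)`
is a Heyting implication, and consequently the underlying lattice is
distributive. -/
theorem faithful_nabla_heyting {A : Type*} [Lattice A] [BoundedOrder A]
    (nab : A → A) (arr : A → A → A)
    (adj : ∀ a b c : A, nab c ⊓ a ≤ b ↔ c ≤ arr a b)
    (faithful : Function.Surjective nab) :
    (∀ a b c : A, c ⊓ a ≤ b ↔ c ≤ nab (arr a b)) ∧
    (∀ x y z : A, x ⊓ (y ⊔ z) = (x ⊓ y) ⊔ (x ⊓ z)) := by
  have gc : GaloisConnection nab (arr ⊤) := fun c b => by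
    simpa only [inf_top_eq] using adj ⊤ b c
  have heyting : ∀ a b c : A, c ⊓ a ≤ b ↔ c ≤ nab (arr a b) := by
    intro a b c
    constructor
    · obtain ⟨d, rfl⟩ := faithful c
      exact fun h => gc.monotone_l ((adj a b d).1 h)
    · exact fun h => (inf_le_inf_right a h).trans ((adj a b _).2 le_rfl)
  refine ⟨heyting, fun x y z => le_antisymm ?_ le_inf_sup⟩
  rw [inf_comm, heyting]
  refine sup_le ((heyting _ _ _).1 ?_) ((heyting _ _ _).1 ?_)
  · rw [inf_comm]
    exact le_sup_left
  · rw [inf_comm]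
    exact le_sup_right
end

section
/- Let A be a bounded lattice equipped with a unary operation ∇ : A → A and a binary operation → : A × A → A. Then (A, ∇, →) is a ∇-algebra (i.e., the adjunction ∇c ⊓ a ≤ b ⟺ c ≤ a → b holds for all a, b, c) if and only if the following four (in)equalities hold for all a, b, c ∈ A: (2) (a ⊓ b) → a = 1; (3) ∇(a ⊓ b) ≤ ∇a ⊓ ∇b; (4) a ⊓ ∇(a → b) ≤ b; (5) c ⊓ ((∇c ⊓ a) → b) ≤ a → b. -/
/-- Equational axiomatization of ∇-algebras. A bounded lattice
with operations `nab` and `arr` satisfies the adjunction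
`∇c ⊓ a ≤ b ↔ c ≤ a → b` iff it satisfies the four (in)equalities
(2) `(a ⊓ b) → a = 1`, (3) `∇(a ⊓ b) ≤ ∇a ⊓ ∇b`, (4) `a ⊓ ∇(a → b) ≤ b`,
(5) `c ⊓ ((∇c ⊓ a) → b) ≤ a → b`. -/
theorem nabla_axiomatization {A : Type*} [Lattice A] [BoundedOrder A]
    (nab : A → A) (arr : A → A → A) :
    (∀ a b c : A, nab c ⊓ a ≤ b ↔ c ≤ arr a b) ↔
      ((∀ a b : A, arr (a ⊓ b) a = ⊤) ∧
       (∀ a b : A, nab (a ⊓ b) ≤ nab a ⊓ nab b) ∧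
       (∀ a b : A, a ⊓ nab (arr a b) ≤ b) ∧
       (∀ a b c : A, c ⊓ arr (nab c ⊓ a) b ≤ arr a b)) := by
  constructor
  · intro adj
    have mono : Monotone nab := fun x y hxy => by
      have h : y ≤ arr ⊤ (nab y) := (adj _ _ _).1 inf_le_left
      simpa using (adj _ _ _).2 (hxy.trans h)
    have modus_ponens (a b : A) : a ⊓ nab (arr a b) ≤ b := by
      rw [inf_comm]
      exact (adj _ _ _).2 le_rfl
    refine ⟨fun a b => top_le_iff.1 ((adj _ _ _).1 (inf_le_right.trans inf_le_left)),
      fun a b => le_inf (mono inf_le_left) (mono inf_le_right), modus_ponens,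
      fun a b c => (adj _ _ _).1 ?_⟩
    refine le_trans ?_ (modus_ponens (nab c ⊓ a) b)
    exact le_inf (inf_le_inf_right a (mono inf_le_left))
      (inf_le_left.trans (mono inf_le_right))
  · rintro ⟨arr_inf_left, nab_inf_le, modus_ponens, inf_arr_le⟩ a b c
    constructor
    · intro h
      have htop : arr (nab c ⊓ a) b = ⊤ := by
        simpa only [inf_eq_right.2 h] using arr_inf_left b (nab c ⊓ a)
      simpa only [htop, inf_top_eq] using inf_arr_le a b c
    · intro h
      have hnab : nab c ≤ nab (arr a b) := by
        simpa only [inf_eq_left.2 h] using (nab_inf_le c (arr a b)).trans inf_le_right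
      exact (le_inf inf_le_right (inf_le_left.trans hnab)).trans (modus_ponens a b)
end

section
/- Let A be a ∇-algebra. Then → is a meet-internalizing implication: (i) a → a = 1 for all a; (ii) (a → b) ⊓ (b → c) ≤ a → c for all a, b, c; (iii) → is antitone in its first argument and monotone in its second; (iv) a → (b ⊓ c) = (a → b) ⊓ (a → c) for all a, b, c. Moreover, if the underlying lattice of A is distributive, then → is also join-internalizing: (a ⊔ b) → c = (a → c) ⊓ (b → c) for all a, b, c. -/
/-- In any ∇-algebra, `→` is a meet-internalizing implication:
(i) `a → a = 1`; (ii) `(a → b) ⊓ (b → c) ≤ a → c`; (iii) `→` is antitone in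
its first and monotone in its second argument;
(iv) `a → (b ⊓ c) = (a → b) ⊓ (a → c)`. Moreover, if the lattice is
distributive then `→` is join-internalizing:
`(a ⊔ b) → c = (a → c) ⊓ (b → c)`. -/
theorem nabla_arrow_implication {A : Type*} [Lattice A] [BoundedOrder A]
    (nab : A → A) (arr : A → A → A)
    (adj : ∀ a b c : A, nab c ⊓ a ≤ b ↔ c ≤ arr a b) :
    (∀ a : A, arr a a = ⊤) ∧
    (∀ a b c : A, arr a b ⊓ arr b c ≤ arr a c) ∧
    (∀ b : A, Antitone fun a => arr a b) ∧
    (∀ a : A, Monotone (arr a)) ∧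
    (∀ a b c : A, arr a (b ⊓ c) = arr a b ⊓ arr a c) ∧
    ((∀ x y z : A, x ⊓ (y ⊔ z) = (x ⊓ y) ⊔ (x ⊓ z)) →
      ∀ a b c : A, arr (a ⊔ b) c = arr a c ⊓ arr b c) := by
  have elim : ∀ {a b c : A}, c ≤ arr a b → nab c ⊓ a ≤ b := fun h => (adj _ _ _).2 h
  have intro : ∀ {a b c : A}, nab c ⊓ a ≤ b → c ≤ arr a b := fun h => (adj _ _ _).1 h
  have anti : ∀ b : A, Antitone fun a => arr a b := fun _ _ _ h =>
    intro ((inf_le_inf_left _ h).trans (elim le_rfl))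
  have mono : ∀ a : A, Monotone (arr a) := fun _ _ _ h => intro ((elim le_rfl).trans h)
  refine ⟨fun a => top_le_iff.1 (intro inf_le_right), fun a b c => intro ?_, anti, mono,
    fun a b c => le_antisymm ?_ ?_, fun distrib a b c => le_antisymm ?_ ?_⟩
  · exact (le_inf inf_le_left (elim inf_le_left)).trans (elim inf_le_right)
  · exact le_inf (mono a inf_le_left) (mono a inf_le_right)
  · exact intro (le_inf (elim inf_le_left) (elim inf_le_right))
  · exact le_inf (anti c le_sup_left) (anti c le_sup_right)
  · refine intro ?_
    rw [distrib]
    exact sup_le (elim inf_le_left) (elim inf_le_right)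
end

section
/- Let X be a frame (a complete lattice in which finite meets distribute over arbitrary joins, with Heyting implication ⇨) and let → be an implication on X, i.e., a binary operation antitone in its first argument and monotone in its second satisfying a → a = 1 and (a → b) ⊓ (b → c) ≤ a → c for all a, b, c. Then the following are equivalent: (i) there is an operation ∇ : X → X such that for all a, b, c: ∇c ⊓ a ≤ b if and only if c ≤ a → b; (ii) → internalizes arbitrary meets and the Heyting implication, i.e., a → ⨅_{i∈I} b_i = ⨅_{i∈I} (a → b_i) for every a and every family {b_i}_{i∈I}, and a → (b ⇨ c) = (a ⊓ b) → c for all a, b, c; (iii) the operation □ defined by □a := 1 → a preserves arbitrary meets, and b → c = □(b ⇨ c) for all b, c. -/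
/-- A map between complete lattices preserving arbitrary meets has a lower adjoint. -/
theorem exists_galoisConnection_of_map_sInf {X Y : Type*} [CompleteLattice X] [CompleteLattice Y]
    (f : X → Y) (hf : ∀ S : Set X, f (sInf S) = ⨅ b ∈ S, f b) :
    ∃ g : Y → X, GaloisConnection g f := by
  have hmono : Monotone f := fun x y hxy => by
    have h := hf {x, y}
    rw [sInf_pair, inf_eq_left.mpr hxy, iInf_pair] at h
    exact h.trans_le inf_le_right
  refine ⟨fun c => sInf {x | c ≤ f x}, fun c x => ⟨fun h => ?_, fun h => sInf_le h⟩⟩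
  refine le_trans ?_ (hmono h)
  rw [hf]
  exact le_iInf₂ fun _ hb => hb

section Nabla

variable {X : Type*} [Order.Frame X] {arr : X → X → X}

theorem arr_sInf_of_nabla {nab : X → X} (h : ∀ a b c : X, nab c ⊓ a ≤ b ↔ c ≤ arr a b)
    (a : X) (S : Set X) : arr a (sInf S) = ⨅ b ∈ S, arr a b :=
  eq_of_forall_le_iff fun x => by simp only [← h, le_sInf_iff, le_iInf_iff]

theorem arr_himp_of_nabla {nab : X → X} (h : ∀ a b c : X, nab c ⊓ a ≤ b ↔ c ≤ arr a b)
    (a b c : X) : arr a (b ⇨ c) = arr (a ⊓ b) c :=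
  eq_of_forall_le_iff fun x => by simp only [← h, le_himp_iff, inf_assoc]

theorem exists_nabla_of_box (hmeet : ∀ S : Set X, arr ⊤ (sInf S) = ⨅ b ∈ S, arr ⊤ b)
    (hbox : ∀ b c : X, arr b c = arr ⊤ (b ⇨ c)) :
    ∃ nab : X → X, ∀ a b c : X, nab c ⊓ a ≤ b ↔ c ≤ arr a b := by
  obtain ⟨nab, hnab⟩ := exists_galoisConnection_of_map_sInf (arr ⊤) hmeet
  exact ⟨nab, fun a b c => by rw [hbox, ← hnab c, le_himp_iff]⟩

theorem arr_eq_box_himp (h : ∀ a b c : X, arr a (b ⇨ c) = arr (a ⊓ b) c) (b c : X) :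
    arr b c = arr ⊤ (b ⇨ c) := by
  rw [h, top_inf_eq]

end Nabla

/-- Let `X` be a frame with Heyting implication `⇨` and let
`arr` be an implication on `X` (antitone/monotone, internally reflexive and
transitive). TFAE: (i) there is `∇` making `(X, ∇, arr)` a ∇-algebra;
(ii) `arr` internalizes arbitrary meets and the Heyting implication;
(iii) `□ := arr ⊤` preserves arbitrary meets and `arr b c = □(b ⇨ c)`. -/
theorem strong_alg_vs_nabla {X : Type*} [Order.Frame X] (arr : X → X → X)
    (h_anti : ∀ b : X, Antitone fun a => arr a b)
    (h_mono : ∀ a : X, Monotone (arr a))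
    (h_refl : ∀ a : X, arr a a = ⊤)
    (h_trans : ∀ a b c : X, arr a b ⊓ arr b c ≤ arr a c) :
    ((∃ nab : X → X, ∀ a b c : X, nab c ⊓ a ≤ b ↔ c ≤ arr a b) ↔
      ((∀ (a : X) (S : Set X), arr a (sInf S) = ⨅ b ∈ S, arr a b) ∧
       (∀ a b c : X, arr a (b ⇨ c) = arr (a ⊓ b) c))) ∧
    ((∃ nab : X → X, ∀ a b c : X, nab c ⊓ a ≤ b ↔ c ≤ arr a b) ↔
      ((∀ S : Set X, arr ⊤ (sInf S) = ⨅ b ∈ S, arr ⊤ b) ∧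
       (∀ b c : X, arr b c = arr ⊤ (b ⇨ c)))) := by
  refine ⟨⟨?_, ?_⟩, ⟨?_, ?_⟩⟩
  · rintro ⟨nab, h⟩
    exact ⟨arr_sInf_of_nabla h, arr_himp_of_nabla h⟩
  · rintro ⟨hmeet, himp⟩
    exact exists_nabla_of_box (hmeet ⊤) (arr_eq_box_himp himp)
  · rintro ⟨nab, h⟩
    exact ⟨arr_sInf_of_nabla h ⊤, arr_eq_box_himp (arr_himp_of_nabla h)⟩
  · rintro ⟨hmeet, hbox⟩
    exact exists_nabla_of_box hmeet hbox
end

section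
/- Let A be a normal ∇-algebra and S ⊆ A. Then the set m(S) = { y ∈ A | there exist a finite index set I and, for each i ∈ I, natural numbers m_i, n_i and elements s_i ∈ S such that ⨅_{i∈I} ∇^{m_i} □^{n_i} s_i ≤ y } is the least modal filter of A containing S. -/
/-- A modal filter of a normal ∇-algebra: an upward closed subset containing
`⊤`, closed under binary meets and under `∇` and `□` (where `□x = ⊤ → x`). -/
def IsModalFilter {A : Type*} [Lattice A] [BoundedOrder A]
    (nab : A → A) (arr : A → A → A) (F : Set A) : Prop :=
  ⊤ ∈ F ∧ (∀ x y : A, x ∈ F → x ≤ y → y ∈ F) ∧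
    (∀ x y : A, x ∈ F → y ∈ F → x ⊓ y ∈ F) ∧
    (∀ x : A, x ∈ F → nab x ∈ F) ∧ (∀ x : A, x ∈ F → arr ⊤ x ∈ F)

/-- In a normal ∇-algebra, the set
`m(S) = { y | ∃ finite I, ∀ i ∈ I, ∃ mᵢ nᵢ ∈ ℕ, sᵢ ∈ S, ⨅ᵢ ∇^{mᵢ} □^{nᵢ} sᵢ ≤ y }`
is the least modal filter containing `S`. -/
theorem generated_modal_filter {A : Type*} [Lattice A] [BoundedOrder A]
    (nab : A → A) (arr : A → A → A)
    (adj : ∀ a b c : A, nab c ⊓ a ≤ b ↔ c ≤ arr a b)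
    (ntop : nab ⊤ = ⊤) (ninf : ∀ a b : A, nab (a ⊓ b) = nab a ⊓ nab b)
    (S : Set A) :
    IsModalFilter nab arr
      {y | ∃ (n : ℕ) (m k : Fin n → ℕ) (s : Fin n → A), (∀ i, s i ∈ S) ∧
        (Finset.univ.inf fun i => nab^[m i] ((arr ⊤)^[k i] (s i))) ≤ y} ∧
    S ⊆ {y | ∃ (n : ℕ) (m k : Fin n → ℕ) (s : Fin n → A), (∀ i, s i ∈ S) ∧
        (Finset.univ.inf fun i => nab^[m i] ((arr ⊤)^[k i] (s i))) ≤ y} ∧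
    ∀ F : Set A, IsModalFilter nab arr F → S ⊆ F →
      {y | ∃ (n : ℕ) (m k : Fin n → ℕ) (s : Fin n → A), (∀ i, s i ∈ S) ∧
        (Finset.univ.inf fun i => nab^[m i] ((arr ⊤)^[k i] (s i))) ≤ y} ⊆ F := by
  have gc : GaloisConnection nab (arr ⊤) := fun c b => by simpa using adj ⊤ b c
  have nab_inf {n : ℕ} (f : Fin n → A) :
      nab (Finset.univ.inf f) = Finset.univ.inf fun i => nab (f i) :=
    Finset.apply_inf_eq_inf_comp nab ninf ntop
  have box_inf {n : ℕ} (f : Fin n → A) :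
      arr ⊤ (Finset.univ.inf f) = Finset.univ.inf fun i => arr ⊤ (f i) :=
    Finset.apply_inf_eq_inf_comp (arr ⊤) (fun _ _ => gc.u_inf) gc.u_top
  refine ⟨⟨?_, ?_, ?_, ?_, ?_⟩, ?_, ?_⟩
  · exact ⟨0, Fin.elim0, Fin.elim0, Fin.elim0, fun i => i.elim0, le_top⟩
  · rintro x y ⟨n, m, k, s, hs, hx⟩ hxy
    exact ⟨n, m, k, s, hs, hx.trans hxy⟩
  · rintro x y ⟨n, m, k, s, hs, hx⟩ ⟨n', m', k', s', hs', hy⟩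
    refine ⟨n + n', Fin.append m m', Fin.append k k', Fin.append s s', fun i => ?_,
      le_inf (le_trans (Finset.le_inf fun i _ => ?_) hx)
        (le_trans (Finset.le_inf fun i _ => ?_) hy)⟩
    · refine Fin.addCases (fun i => ?_) (fun i => ?_) i
      · simpa using hs i
      · simpa using hs' i
    · exact (Finset.inf_le (Finset.mem_univ (Fin.castAdd n' i))).trans (by simp)
    · exact (Finset.inf_le (Finset.mem_univ (Fin.natAdd n i))).trans (by simp)
  · rintro x ⟨n, m, k, s, hs, hx⟩
    refine ⟨n, fun i => m i + 1, k, s, hs, ?_⟩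
    simpa only [Function.iterate_succ_apply', nab_inf] using gc.monotone_l hx
  · rintro x ⟨n, m, k, s, hs, hx⟩
    refine ⟨n, fun i => m i - 1, fun i => if m i = 0 then k i + 1 else k i, s, hs, ?_⟩
    refine le_trans ?_ (gc.monotone_u hx)
    rw [box_inf]
    refine Finset.inf_mono_fun fun i _ => ?_
    rcases h : m i with _ | j
    · simp [h, Function.iterate_succ_apply']
    · simpa [h, Function.iterate_succ_apply'] using gc.le_u_l _
  · intro x hx
    exact ⟨1, fun _ => 0, fun _ => 0, fun _ => x, fun _ => hx, by simp⟩
  · rintro F ⟨htop, hup, hinf, hnab, hbox⟩ hSF y ⟨n, m, k, s, hs, hy⟩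
    refine hup _ _ (Finset.inf_induction htop (fun a ha b hb => hinf a b ha hb) fun i _ => ?_) hy
    have hboxes := Set.MapsTo.iterate (f := arr ⊤) (s := F) hbox (k i) (hSF (hs i))
    exact Set.MapsTo.iterate (f := nab) hnab (m i) hboxes
end

section
/- Let A be a normal distributive ∇-algebra. Then for all x, y, z ∈ A: (1) x → y ≤ (x ⊓ z) → (y ⊓ z); (2) x → y ≤ (x ⊔ z) → (y ⊔ z); (3) ∇(x → y) ≤ ∇x → ∇y; (4) □(x → y) ≤ (z → x) → (z → y); (5) □(x → y) ≤ (y → z) → (x → z). If moreover the underlying lattice of A is a Heyting algebra with Heyting implication ⊃, then also: (6) x → y ≤ (z ⊃ x) → (z ⊃ y); (7) x → y ≤ (y ⊃ z) → (x ⊃ z). -/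
/-- In a normal distributive ∇-algebra the inequalities
(1)–(5) hold, and if the underlying lattice is moreover Heyting (with
Heyting implication `himp`, characterized by `c ⊓ a ≤ b ↔ c ≤ himp a b`),
also (6) and (7) hold. Here `□x = ⊤ → x`. -/
theorem internal_cong_inequalities {A : Type*} [DistribLattice A] [BoundedOrder A]
    (nab : A → A) (arr : A → A → A)
    (adj : ∀ a b c : A, nab c ⊓ a ≤ b ↔ c ≤ arr a b)
    (ntop : nab ⊤ = ⊤) (ninf : ∀ a b : A, nab (a ⊓ b) = nab a ⊓ nab b) :
    (∀ x y z : A, arr x y ≤ arr (x ⊓ z) (y ⊓ z)) ∧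
    (∀ x y z : A, arr x y ≤ arr (x ⊔ z) (y ⊔ z)) ∧
    (∀ x y : A, nab (arr x y) ≤ arr (nab x) (nab y)) ∧
    (∀ x y z : A, arr ⊤ (arr x y) ≤ arr (arr z x) (arr z y)) ∧
    (∀ x y z : A, arr ⊤ (arr x y) ≤ arr (arr y z) (arr x z)) ∧
    (∀ himp : A → A → A, (∀ a b c : A, c ⊓ a ≤ b ↔ c ≤ himp a b) →
      (∀ x y z : A, arr x y ≤ arr (himp z x) (himp z y)) ∧
      (∀ x y z : A, arr x y ≤ arr (himp y z) (himp x z))) := by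
  have mp : ∀ a b, nab (arr a b) ⊓ a ≤ b := fun a b => (adj a b _).2 le_rfl
  have mono : Monotone nab := fun a b h => by
    rw [← inf_eq_left, ← ninf, inf_eq_left.2 h]
  have box_le : ∀ a, nab (arr ⊤ a) ≤ a := fun a => by simpa using mp ⊤ a
  have comp : ∀ x y z, arr x y ⊓ arr y z ≤ arr x z := fun x y z => by
    rw [← adj, ninf]
    exact (le_inf (inf_le_left.trans inf_le_right)
      ((inf_le_inf_right x inf_le_left).trans (mp x y))).trans (mp y z)
  refine ⟨fun x y z => ?_, fun x y z => ?_, fun x y => ?_, fun x y z => ?_, fun x y z => ?_,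
    fun himp hadj => ⟨fun x y z => ?_, fun x y z => ?_⟩⟩
  · rw [← adj, ← inf_assoc]
    exact inf_le_inf_right z (mp x y)
  · rw [← adj, inf_sup_left]
    exact sup_le_sup (mp x y) inf_le_right
  · rw [← adj, ← ninf]
    exact mono (mp x y)
  · rw [← adj, inf_comm]
    exact (inf_le_inf_left _ (box_le _)).trans (comp z x y)
  · rw [← adj]
    exact (inf_le_inf_right _ (box_le _)).trans (comp x y z)
  · rw [← adj, ← hadj, inf_assoc]
    exact (inf_le_inf_left _ ((hadj z x _).2 le_rfl)).trans (mp x y)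
  · rw [← adj, ← hadj, inf_right_comm, inf_comm]
    exact (inf_le_inf_left _ (mp x y)).trans ((hadj y z _).2 le_rfl)
end

section
/- Let A be a normal distributive ∇-algebra. For a modal filter F define α(F) = { (x, y) ∈ A × A | (x → y) ⊓ (y → x) ∈ F }, and for a congruence θ define β(θ) = { x ∈ A | (x, 1) ∈ θ }. Then: (i) α(F) is a congruence on A for every modal filter F; (ii) β(θ) is a modal filter for every congruence θ; (iii) α(β(θ)) = θ and β(α(F)) = F; (iv) α and β are monotone with respect to inclusion. Hence α and β form an order isomorphism between the poset of modal filters of A and the poset of congruences on A. -/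
/-- A congruence on a ∇-algebra: an equivalence relation compatible with
`⊓`, `⊔`, `∇` and `→`. -/
def IsNablaCong {A : Type*} [Lattice A]
    (nab : A → A) (arr : A → A → A) (θ : A → A → Prop) : Prop :=
  Equivalence θ ∧
    (∀ a b c d : A, θ a b → θ c d → θ (a ⊓ c) (b ⊓ d)) ∧
    (∀ a b c d : A, θ a b → θ c d → θ (a ⊔ c) (b ⊔ d)) ∧
    (∀ a b : A, θ a b → θ (nab a) (nab b)) ∧
    (∀ a b c d : A, θ a b → θ c d → θ (arr a c) (arr b d))

section NablaAlgebra

variable {A : Type*} {nab : A → A} {arr : A → A → A}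

theorem arr_self_eq_top [Lattice A] [BoundedOrder A]
    (adj : ∀ a b c : A, nab c ⊓ a ≤ b ↔ c ≤ arr a b) (a : A) : arr a a = ⊤ :=
  top_le_iff.1 ((adj _ _ _).1 inf_le_right)

theorem arr_top_right_eq_top [Lattice A] [BoundedOrder A]
    (adj : ∀ a b c : A, nab c ⊓ a ≤ b ↔ c ≤ arr a b) (a : A) : arr a ⊤ = ⊤ :=
  top_le_iff.1 ((adj _ _ _).1 le_top)

theorem nab_arr_top_le [Lattice A] [BoundedOrder A]
    (adj : ∀ a b c : A, nab c ⊓ a ≤ b ↔ c ≤ arr a b) (a : A) : nab (arr ⊤ a) ≤ a := by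
  simpa using (adj ⊤ a _).2 le_rfl

/-- Membership of an implication in a modal filter is relative order modulo the filter. -/
theorem IsModalFilter.arr_mem_iff [Lattice A] [BoundedOrder A] {F : Set A}
    (hF : IsModalFilter nab arr F)
    (adj : ∀ a b c : A, nab c ⊓ a ≤ b ↔ c ≤ arr a b) {x y : A} :
    arr x y ∈ F ↔ ∃ f ∈ F, f ⊓ x ≤ y := by
  obtain ⟨-, up, -, hnab, hbox⟩ := hF
  refine ⟨fun h => ⟨_, hnab _ h, (adj _ _ _).2 le_rfl⟩, fun ⟨f, hf, h⟩ => ?_⟩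
  exact up _ _ (hbox f hf)
    ((adj _ _ _).1 ((inf_le_inf_right x (nab_arr_top_le adj f)).trans h))

theorem IsModalFilter.arr_inf_arr_mem_iff [Lattice A] [BoundedOrder A] {F : Set A}
    (hF : IsModalFilter nab arr F)
    (adj : ∀ a b c : A, nab c ⊓ a ≤ b ↔ c ≤ arr a b) {x y : A} :
    arr x y ⊓ arr y x ∈ F ↔ ∃ f ∈ F, f ⊓ x = f ⊓ y := by
  have key : arr x y ⊓ arr y x ∈ F ↔ arr x y ∈ F ∧ arr y x ∈ F :=
    ⟨fun h => ⟨hF.2.1 _ _ h inf_le_left, hF.2.1 _ _ h inf_le_right⟩,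
      fun h => hF.2.2.1 _ _ h.1 h.2⟩
  rw [key, hF.arr_mem_iff adj, hF.arr_mem_iff adj]
  constructor
  · rintro ⟨⟨f, hf, hxy⟩, g, hg, hyx⟩
    refine ⟨f ⊓ g, hF.2.2.1 _ _ hf hg, le_antisymm ?_ ?_⟩
    · exact le_inf inf_le_left ((inf_le_inf_right x inf_le_left).trans hxy)
    · exact le_inf inf_le_left ((inf_le_inf_right y inf_le_right).trans hyx)
  · rintro ⟨f, hf, h⟩
    exact ⟨⟨f, hf, h.le.trans inf_le_right⟩, f, hf, h.ge.trans inf_le_right⟩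

theorem inf_arr_le_arr [Lattice A] [BoundedOrder A]
    (adj : ∀ a b c : A, nab c ⊓ a ≤ b ↔ c ≤ arr a b)
    (ninf : ∀ a b : A, nab (a ⊓ b) = nab a ⊓ nab b) {f a b c d : A}
    (hab : f ⊓ b ≤ a) (hcd : f ⊓ c ≤ d) : arr ⊤ f ⊓ arr a c ≤ arr b d := by
  rw [← adj, ninf]
  have hf : nab (arr ⊤ f) ⊓ nab (arr a c) ⊓ b ≤ f :=
    inf_le_left.trans (inf_le_left.trans (nab_arr_top_le adj f))
  have ha : nab (arr ⊤ f) ⊓ nab (arr a c) ⊓ b ≤ a := (le_inf hf inf_le_right).trans hab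
  have hc : nab (arr ⊤ f) ⊓ nab (arr a c) ⊓ b ≤ c :=
    (le_inf (inf_le_left.trans inf_le_right) ha).trans ((adj a c _).2 le_rfl)
  exact (le_inf hf hc).trans hcd

theorem IsModalFilter.isNablaCong [DistribLattice A] [BoundedOrder A] {F : Set A}
    (hF : IsModalFilter nab arr F)
    (adj : ∀ a b c : A, nab c ⊓ a ≤ b ↔ c ≤ arr a b)
    (ninf : ∀ a b : A, nab (a ⊓ b) = nab a ⊓ nab b) :
    IsNablaCong nab arr fun x y => arr x y ⊓ arr y x ∈ F := by
  simp only [hF.arr_inf_arr_mem_iff adj]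
  obtain ⟨htop, -, hinf, hnab, hbox⟩ := hF
  have common : ∀ {a b c d : A}, (∃ f ∈ F, f ⊓ a = f ⊓ b) → (∃ f ∈ F, f ⊓ c = f ⊓ d) →
      ∃ f ∈ F, f ⊓ a = f ⊓ b ∧ f ⊓ c = f ⊓ d := by
    rintro a b c d ⟨f, hf, hab⟩ ⟨g, hg, hcd⟩
    refine ⟨f ⊓ g, hinf _ _ hf hg, ?_, ?_⟩
    · rw [inf_right_comm, hab, inf_right_comm]
    · rw [inf_assoc, hcd, inf_assoc]
  refine ⟨⟨fun x => ⟨⊤, htop, rfl⟩, fun ⟨f, hf, h⟩ => ⟨f, hf, h.symm⟩, fun h₁ h₂ => ?_⟩,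
    fun a b c d h₁ h₂ => ?_, fun a b c d h₁ h₂ => ?_, ?_, fun a b c d h₁ h₂ => ?_⟩
  · obtain ⟨f, hf, hab, hcd⟩ := common h₁ h₂
    exact ⟨f, hf, hab.trans hcd⟩
  · obtain ⟨f, hf, hab, hcd⟩ := common h₁ h₂
    exact ⟨f, hf, by rw [inf_inf_distrib_left, hab, hcd, ← inf_inf_distrib_left]⟩
  · obtain ⟨f, hf, hab, hcd⟩ := common h₁ h₂
    exact ⟨f, hf, by rw [inf_sup_left, hab, hcd, ← inf_sup_left]⟩
  · rintro a b ⟨f, hf, h⟩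
    exact ⟨nab f, hnab _ hf, by rw [← ninf, h, ninf]⟩
  · obtain ⟨f, hf, hab, hcd⟩ := common h₁ h₂
    refine ⟨arr ⊤ f, hbox _ hf, le_antisymm ?_ ?_⟩
    · exact le_inf inf_le_left (inf_arr_le_arr adj ninf
        (hab.ge.trans inf_le_right) (hcd.le.trans inf_le_right))
    · exact le_inf inf_le_left (inf_arr_le_arr adj ninf
        (hab.le.trans inf_le_right) (hcd.ge.trans inf_le_right))

theorem IsNablaCong.isModalFilter [Lattice A] [BoundedOrder A] {θ : A → A → Prop}
    (hθ : IsNablaCong nab arr θ)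
    (adj : ∀ a b c : A, nab c ⊓ a ≤ b ↔ c ≤ arr a b) (ntop : nab ⊤ = ⊤) :
    IsModalFilter nab arr {x | θ x ⊤} := by
  obtain ⟨heqv, hinf, hsup, hnab, harr⟩ := hθ
  refine ⟨heqv.refl _, fun x y hx hxy => ?_, fun x y hx hy => ?_, fun x hx => ?_,
    fun x hx => ?_⟩
  · simpa [sup_eq_right.2 hxy] using hsup _ _ _ _ hx (heqv.refl y)
  · simpa using hinf _ _ _ _ hx hy
  · simpa [ntop] using hnab _ _ hx
  · simpa [arr_self_eq_top adj] using harr _ _ _ _ (heqv.refl ⊤) hx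

theorem IsNablaCong.arr_inf_arr_top_iff [Lattice A] [BoundedOrder A] {θ : A → A → Prop}
    (hθ : IsNablaCong nab arr θ)
    (adj : ∀ a b c : A, nab c ⊓ a ≤ b ↔ c ≤ arr a b) (ntop : nab ⊤ = ⊤) {x y : A} :
    θ (arr x y ⊓ arr y x) ⊤ ↔ θ x y := by
  have hF := hθ.isModalFilter adj ntop
  obtain ⟨heqv, hinf, -, -, harr⟩ := hθ
  constructor
  · intro h
    obtain ⟨f, hf, hxy⟩ := (hF.arr_inf_arr_mem_iff adj).1 h
    have hmeet (z : A) : θ (f ⊓ z) z := by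
      simpa using hinf _ _ _ _ hf (heqv.refl z)
    exact heqv.trans (heqv.symm (hmeet x)) (hxy ▸ hmeet y)
  · intro h
    have h₁ : θ (arr x y) ⊤ := by
      simpa [arr_self_eq_top adj] using harr _ _ _ _ h (heqv.refl y)
    have h₂ : θ (arr y x) ⊤ := by
      simpa [arr_self_eq_top adj] using harr _ _ _ _ (heqv.refl y) h
    exact hF.2.2.1 _ _ h₁ h₂

theorem IsModalFilter.arr_top_mem_iff [Lattice A] [BoundedOrder A] {F : Set A}
    (hF : IsModalFilter nab arr F)
    (adj : ∀ a b c : A, nab c ⊓ a ≤ b ↔ c ≤ arr a b) {x : A} :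
    arr ⊤ x ∈ F ↔ x ∈ F :=
  ⟨fun h => hF.2.1 _ _ (hF.2.2.2.1 _ h) (nab_arr_top_le adj x), hF.2.2.2.2 x⟩

end NablaAlgebra

/-- In a normal distributive ∇-algebra, the maps
`α(F) = {(x,y) | (x→y) ⊓ (y→x) ∈ F}` and `β(θ) = {x | θ x ⊤}` give a
one-to-one monotone correspondence between modal filters and congruences. -/
theorem modal_filter_congruence_correspondence {A : Type*}
    [DistribLattice A] [BoundedOrder A]
    (nab : A → A) (arr : A → A → A)
    (adj : ∀ a b c : A, nab c ⊓ a ≤ b ↔ c ≤ arr a b)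
    (ntop : nab ⊤ = ⊤) (ninf : ∀ a b : A, nab (a ⊓ b) = nab a ⊓ nab b) :
    -- (i) α(F) is a congruence
    (∀ F : Set A, IsModalFilter nab arr F →
      IsNablaCong nab arr fun x y => arr x y ⊓ arr y x ∈ F) ∧
    -- (ii) β(θ) is a modal filter
    (∀ θ : A → A → Prop, IsNablaCong nab arr θ →
      IsModalFilter nab arr {x | θ x ⊤}) ∧
    -- (iii) α(β(θ)) = θ and β(α(F)) = F
    (∀ θ : A → A → Prop, IsNablaCong nab arr θ →
      (fun x y => arr x y ⊓ arr y x ∈ {z | θ z ⊤}) = θ) ∧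
    (∀ F : Set A, IsModalFilter nab arr F →
      {x | arr x ⊤ ⊓ arr ⊤ x ∈ F} = F) ∧
    -- (iv) monotonicity of α and β
    (∀ F F' : Set A, IsModalFilter nab arr F → IsModalFilter nab arr F' →
      F ⊆ F' → ∀ x y : A, arr x y ⊓ arr y x ∈ F → arr x y ⊓ arr y x ∈ F') ∧
    (∀ θ θ' : A → A → Prop, IsNablaCong nab arr θ → IsNablaCong nab arr θ' →
      (∀ x y : A, θ x y → θ' x y) → {x | θ x ⊤} ⊆ {x | θ' x ⊤}) := by
  refine ⟨fun F hF => hF.isNablaCong adj ninf, fun θ hθ => hθ.isModalFilter adj ntop,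
    fun θ hθ => ?_, fun F hF => ?_, fun F F' _ _ h x y hxy => h hxy,
    fun θ θ' _ _ h x hx => h x ⊤ hx⟩
  · funext x y
    exact propext (hθ.arr_inf_arr_top_iff adj ntop)
  · ext x
    simp [arr_top_right_eq_top adj, hF.arr_top_mem_iff adj]
end

section
/- Let A be a nontrivial normal distributive ∇-algebra (i.e., A has at least two elements). Then A is subdirectly irreducible — i.e., there is a least congruence among the congruences different from the identity relation — if and only if there exists x ∈ A with x ≠ 1 such that for every y ∈ A with y ≠ 1 there exist a finite index set I and natural numbers m_i, n_i (i ∈ I) satisfying ⨅_{i∈I} ∇^{m_i} □^{n_i} y ≤ x. -/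
/-- Membership in the filter generated by `y` that is closed under `∇` and `□`. -/
inductive GenNablaFilter {A : Type*} [Lattice A] [OrderTop A]
    (nab : A → A) (arr : A → A → A) (y : A) : A → Prop
  | base : GenNablaFilter nab arr y y
  | top : GenNablaFilter nab arr y ⊤
  | inf {a b : A} : GenNablaFilter nab arr y a → GenNablaFilter nab arr y b →
      GenNablaFilter nab arr y (a ⊓ b)
  | nab {a : A} : GenNablaFilter nab arr y a → GenNablaFilter nab arr y (nab a)
  | box {a : A} : GenNablaFilter nab arr y a → GenNablaFilter nab arr y (arr ⊤ a)

theorem arr_top_top {A : Type*} {nab : A → A} {arr : A → A → A} [Lattice A]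
    [OrderTop A] (adj : ∀ a b c : A, nab c ⊓ a ≤ b ↔ c ≤ arr a b) :
    arr ⊤ ⊤ = ⊤ :=
  top_le_iff.1 ((adj _ _ _).1 le_top)

namespace IsNablaCong

variable {A : Type*} {nab : A → A} {arr : A → A → A} {θ : A → A → Prop}

theorem exists_ne_top [Lattice A] [OrderTop A]
    (adj : ∀ a b c : A, nab c ⊓ a ≤ b ↔ c ≤ arr a b) (ntop : nab ⊤ = ⊤)
    (h : IsNablaCong nab arr θ) (hne : θ ≠ (· = ·)) : ∃ y, y ≠ ⊤ ∧ θ y ⊤ := by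
  obtain ⟨he, -, -, -, harr⟩ := h
  have arr_eq_top (a b : A) : arr a b = ⊤ ↔ a ≤ b := by
    rw [← top_le_iff, ← adj, ntop, top_inf_eq]
  by_contra! hall
  have le_of_rel {a b : A} (hab : θ a b) : a ≤ b := by
    by_contra hle
    refine hall (arr a b) (mt (arr_eq_top a b).1 hle) ?_
    rw [← (arr_eq_top b b).2 le_rfl]
    exact harr _ _ _ _ hab (he.refl b)
  refine hne (funext₂ fun a b => propext ⟨fun hab => ?_, fun hab => hab ▸ he.refl a⟩)
  exact le_antisymm (le_of_rel hab) (le_of_rel (he.symm hab))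

theorem inf_rel_top [Lattice A] [OrderTop A] (h : IsNablaCong nab arr θ) {a b : A}
    (ha : θ a ⊤) (hb : θ b ⊤) : θ (a ⊓ b) ⊤ := by
  simpa using h.2.1 _ _ _ _ ha hb

theorem nab_rel_top [Lattice A] [OrderTop A] (ntop : nab ⊤ = ⊤)
    (h : IsNablaCong nab arr θ) {a : A} (ha : θ a ⊤) : θ (nab a) ⊤ := by
  simpa [ntop] using h.2.2.2.1 _ _ ha

theorem box_rel_top [Lattice A] [OrderTop A]
    (adj : ∀ a b c : A, nab c ⊓ a ≤ b ↔ c ≤ arr a b)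
    (h : IsNablaCong nab arr θ) {a : A} (ha : θ a ⊤) : θ (arr ⊤ a) ⊤ := by
  simpa [arr_top_top adj] using h.2.2.2.2 _ _ _ _ (h.1.refl ⊤) ha

theorem rel_top_of_le [Lattice A] [OrderTop A] (h : IsNablaCong nab arr θ) {a b : A}
    (ha : θ a ⊤) (hab : a ≤ b) : θ b ⊤ := by
  simpa [hab] using h.2.2.1 _ _ _ _ ha (h.1.refl b)

theorem rel_of_inf_eq [Lattice A] [OrderTop A] (h : IsNablaCong nab arr θ) {a b f : A}
    (hf : θ f ⊤) (hab : a ⊓ f = b ⊓ f) : θ a b := by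
  have rel_inf (c : A) : θ (c ⊓ f) c := by
    simpa using h.2.1 _ _ _ _ (h.1.refl c) hf
  exact h.1.trans (h.1.symm (rel_inf a)) (hab ▸ rel_inf b)

theorem rel_top_of_gen [Lattice A] [OrderTop A]
    (adj : ∀ a b c : A, nab c ⊓ a ≤ b ↔ c ≤ arr a b) (ntop : nab ⊤ = ⊤)
    (h : IsNablaCong nab arr θ) {y z : A} (hy : θ y ⊤)
    (hz : GenNablaFilter nab arr y z) : θ z ⊤ := by
  induction hz with
  | base => exact hy
  | top => exact h.1.refl ⊤
  | inf _ _ ha hb => exact h.inf_rel_top ha hb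
  | nab _ ha => exact h.nab_rel_top ntop ha
  | box _ ha => exact h.box_rel_top adj ha

theorem iterate_rel_top [Lattice A] [OrderTop A]
    (adj : ∀ a b c : A, nab c ⊓ a ≤ b ↔ c ≤ arr a b) (ntop : nab ⊤ = ⊤)
    (h : IsNablaCong nab arr θ) {y : A} (hy : θ y ⊤) (m k : ℕ) :
    θ (nab^[m] ((arr ⊤)^[k] y)) ⊤ := by
  have hbox : θ ((arr ⊤)^[k] y) ⊤ :=
    Function.Iterate.rec (θ · ⊤) hy (fun _ => h.box_rel_top adj) k
  exact Function.Iterate.rec (θ · ⊤) hbox (fun _ => h.nab_rel_top ntop) m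

end IsNablaCong

namespace GenNablaFilter

variable {A : Type*} {nab : A → A} {arr : A → A → A}

theorem isNablaCong [DistribLattice A] [OrderTop A]
    (adj : ∀ a b c : A, nab c ⊓ a ≤ b ↔ c ≤ arr a b)
    (ninf : ∀ a b : A, nab (a ⊓ b) = nab a ⊓ nab b) (y : A) :
    IsNablaCong nab arr fun a b => ∃ f, GenNablaFilter nab arr y f ∧ a ⊓ f = b ⊓ f := by
  have inf_eq_mono {a b f g : A} (h : a ⊓ f = b ⊓ f) (hg : g ≤ f) : a ⊓ g = b ⊓ g := by
    rw [← inf_eq_right.2 hg, ← inf_assoc, h, inf_assoc]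
  have arr_le {a b c d f : A} (hab : a ⊓ f = b ⊓ f) (hcd : c ⊓ f = d ⊓ f) :
      arr a c ⊓ arr ⊤ f ≤ arr b d := by
    have hf : nab (arr ⊤ f) ≤ f := by simpa using (adj ⊤ f _).2 le_rfl
    have hac : nab (arr a c) ⊓ a ≤ c := (adj _ _ _).2 le_rfl
    rw [← adj, ninf]
    calc nab (arr a c) ⊓ nab (arr ⊤ f) ⊓ b
        ≤ nab (arr a c) ⊓ f ⊓ b := by gcongr
      _ = nab (arr a c) ⊓ a ⊓ f := by rw [inf_assoc, inf_comm f, ← hab, inf_assoc]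
      _ ≤ c ⊓ f := by gcongr
      _ ≤ d := hcd.trans_le inf_le_left
  refine ⟨⟨fun a => ⟨⊤, top, rfl⟩, ?_, ?_⟩, ?_, ?_, ?_, ?_⟩
  · rintro a b ⟨f, hf, h⟩
    exact ⟨f, hf, h.symm⟩
  · rintro a b c ⟨f, hf, h⟩ ⟨g, hg, h'⟩
    exact ⟨f ⊓ g, hf.inf hg, (inf_eq_mono h inf_le_left).trans (inf_eq_mono h' inf_le_right)⟩
  · rintro a b c d ⟨f, hf, h⟩ ⟨g, hg, h'⟩
    exact ⟨f ⊓ g, hf.inf hg, by rw [inf_inf_inf_comm, h, h', inf_inf_inf_comm]⟩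
  · rintro a b c d ⟨f, hf, h⟩ ⟨g, hg, h'⟩
    refine ⟨f ⊓ g, hf.inf hg, ?_⟩
    rw [inf_sup_right, inf_sup_right, inf_eq_mono h inf_le_left, inf_eq_mono h' inf_le_right]
  · rintro a b ⟨f, hf, h⟩
    exact ⟨nab f, hf.nab, by rw [← ninf, h, ninf]⟩
  · rintro a b c d ⟨f, hf, h⟩ ⟨g, hg, h'⟩
    have h := inf_eq_mono h (inf_le_left : f ⊓ g ≤ f)
    have h' := inf_eq_mono h' (inf_le_right : f ⊓ g ≤ g)
    exact ⟨arr ⊤ (f ⊓ g), (hf.inf hg).box,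
      le_antisymm (le_inf (arr_le h h') inf_le_right)
        (le_inf (arr_le h.symm h'.symm) inf_le_right)⟩

theorem cong_ne_eq [Lattice A] [OrderTop A] {y : A} (hy : y ≠ ⊤) :
    (fun a b => ∃ f, GenNablaFilter nab arr y f ∧ a ⊓ f = b ⊓ f) ≠ (· = ·) := by
  intro h
  exact hy ((congrFun₂ h y ⊤).mp ⟨y, base, by simp⟩)

theorem exists_finset_inf_le [Lattice A] [OrderTop A]
    (adj : ∀ a b c : A, nab c ⊓ a ≤ b ↔ c ≤ arr a b) (ntop : nab ⊤ = ⊤)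
    (ninf : ∀ a b : A, nab (a ⊓ b) = nab a ⊓ nab b) {y z : A}
    (hz : GenNablaFilter nab arr y z) :
    ∃ s : Finset (ℕ × ℕ), (s.inf fun p => nab^[p.1] ((arr ⊤)^[p.2] y)) ≤ z := by
  classical
  have gc : GaloisConnection nab (arr ⊤) := fun a b => by simpa using adj ⊤ b a
  induction hz with
  | base => exact ⟨{(0, 0)}, by simp⟩
  | top => exact ⟨∅, le_top⟩
  | inf _ _ ha hb =>
    obtain ⟨s, hs⟩ := ha
    obtain ⟨t, ht⟩ := hb
    exact ⟨s ∪ t, by rw [Finset.inf_union]; exact inf_le_inf hs ht⟩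
  | nab _ ha =>
    obtain ⟨s, hs⟩ := ha
    refine ⟨s.image fun p => (p.1 + 1, p.2), le_trans ?_ (gc.monotone_l hs)⟩
    rw [Finset.apply_inf_eq_inf_comp nab ninf ntop, Finset.inf_image]
    simp [Function.comp_def, Function.iterate_succ_apply']
  | box _ ha =>
    obtain ⟨s, hs⟩ := ha
    refine ⟨s.image fun p => if p.1 = 0 then (0, p.2 + 1) else (p.1 - 1, p.2),
      le_trans ?_ (gc.monotone_u hs)⟩
    rw [Finset.apply_inf_eq_inf_comp (arr ⊤) (fun _ _ => gc.u_inf) gc.u_top, Finset.inf_image]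
    refine Finset.inf_mono_fun fun p _ => ?_
    obtain ⟨_ | m, k⟩ := p
    · simp [Function.iterate_succ_apply']
    · simpa [Function.iterate_succ_apply'] using gc.le_u_l _

end GenNablaFilter

/-- A nontrivial normal distributive ∇-algebra is subdirectly
irreducible (there is a least congruence among those different from the
identity) iff there is `x ≠ ⊤` such that for every `y ≠ ⊤` there are
finitely many iterates with `⨅ᵢ ∇^{mᵢ} □^{nᵢ} y ≤ x`. Here `□ = arr ⊤`. -/
theorem subdirectly_irreducible_characterization {A : Type*}
    [DistribLattice A] [BoundedOrder A] [Nontrivial A]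
    (nab : A → A) (arr : A → A → A)
    (adj : ∀ a b c : A, nab c ⊓ a ≤ b ↔ c ≤ arr a b)
    (ntop : nab ⊤ = ⊤) (ninf : ∀ a b : A, nab (a ⊓ b) = nab a ⊓ nab b) :
    (∃ θ : A → A → Prop, IsNablaCong nab arr θ ∧ θ ≠ (· = ·) ∧
      ∀ θ' : A → A → Prop, IsNablaCong nab arr θ' → θ' ≠ (· = ·) →
        ∀ a b : A, θ a b → θ' a b) ↔
    (∃ x : A, x ≠ ⊤ ∧ ∀ y : A, y ≠ ⊤ → ∃ (n : ℕ) (m k : Fin n → ℕ),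
      (Finset.univ.inf fun i => nab^[m i] ((arr ⊤)^[k i] y)) ≤ x) := by
  constructor
  · rintro ⟨θ, hθ, hne, hmin⟩
    obtain ⟨x, hx, hxt⟩ := hθ.exists_ne_top adj ntop hne
    refine ⟨x, hx, fun y hy => ?_⟩
    obtain ⟨f, hf, hxf⟩ := hmin _ (GenNablaFilter.isNablaCong adj ninf y)
      (GenNablaFilter.cong_ne_eq hy) x ⊤ hxt
    obtain ⟨s, hs⟩ := hf.exists_finset_inf_le adj ntop ninf
    have hfx : f ≤ x := by simpa using hxf
    refine ⟨s.card, fun i => (s.equivFin.symm i).1.1, fun i => (s.equivFin.symm i).1.2,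
      le_trans (Finset.le_inf fun p hp => ?_) (hs.trans hfx)⟩
    exact Finset.inf_le_of_le (Finset.mem_univ (s.equivFin ⟨p, hp⟩)) (by simp)
  · rintro ⟨x, hx, hgen⟩
    refine ⟨_, GenNablaFilter.isNablaCong adj ninf x, GenNablaFilter.cong_ne_eq hx, ?_⟩
    rintro θ hθ hne a b ⟨f, hf, hab⟩
    obtain ⟨y, hy, hyt⟩ := hθ.exists_ne_top adj ntop hne
    obtain ⟨n, m, k, hle⟩ := hgen y hy
    have hinf : θ (Finset.univ.inf fun i => nab^[m i] ((arr ⊤)^[k i] y)) ⊤ :=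
      Finset.inf_induction (p := (θ · ⊤)) (hθ.1.refl ⊤) (fun _ ha _ hb => hθ.inf_rel_top ha hb)
        fun i _ => hθ.iterate_rel_top adj ntop hyt (m i) (k i)
    have hxt := hθ.rel_top_of_le hinf hle
    exact hθ.rel_of_inf_eq (hθ.rel_top_of_gen adj ntop hxt hf) hab
end

section
/- Let A be a normal distributive ∇-algebra. Then A is simple — i.e., its only congruences are the identity relation and the full relation A × A — if and only if for every x ∈ A with x ≠ 1 there exist a finite index set I and natural numbers m_i, n_i (i ∈ I) satisfying ⨅_{i∈I} ∇^{m_i} □^{n_i} x = 0. -/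
section NablaAlgebra

variable {A : Type*} [DistribLattice A] [BoundedOrder A] {nab : A → A} {arr : A → A → A}

/-- The relation identifying two elements whose meets with some element of `F` agree. -/
def filterRel (F : Set A) (a b : A) : Prop := ∃ f ∈ F, a ⊓ f = b ⊓ f

/-- The up-closure of the finite meets of the elements `∇^m □^n x`. -/
def generatedFilter (nab : A → A) (arr : A → A → A) (x : A) : Set A :=
  {y | ∃ s : Finset (ℕ × ℕ), (s.inf fun p => nab^[p.1] ((arr ⊤)^[p.2] x)) ≤ y}

theorem arr_mono_on_inf (adj : ∀ a b c : A, nab c ⊓ a ≤ b ↔ c ≤ arr a b)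
    {a b c d f : A} (hab : a ⊓ f = b ⊓ f) (hcd : c ⊓ f = d ⊓ f) :
    arr a c ⊓ arr ⊤ f ≤ arr b d ⊓ arr ⊤ f := by
  refine le_inf ?_ inf_le_right
  rw [← adj]
  have hf : nab (arr a c ⊓ arr ⊤ f) ≤ f := by
    simpa using (adj ⊤ f _).2 (inf_le_right : arr a c ⊓ arr ⊤ f ≤ _)
  have hc := (adj a c _).2 (inf_le_left : arr a c ⊓ arr ⊤ f ≤ _)
  have hbf : nab (arr a c ⊓ arr ⊤ f) ⊓ b ≤ a ⊓ f :=
    hab ▸ le_inf inf_le_right (inf_le_left.trans hf)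
  have hcf : nab (arr a c ⊓ arr ⊤ f) ⊓ b ≤ c ⊓ f :=
    le_inf ((le_inf inf_le_left (hbf.trans inf_le_left)).trans hc) (hbf.trans inf_le_right)
  exact hcf.trans (hcd.le.trans inf_le_left)

theorem isNablaCong_filterRel (adj : ∀ a b c : A, nab c ⊓ a ≤ b ↔ c ≤ arr a b)
    (ninf : ∀ a b : A, nab (a ⊓ b) = nab a ⊓ nab b) {F : Set A}
    (htop : ⊤ ∈ F) (hinf : ∀ a ∈ F, ∀ b ∈ F, a ⊓ b ∈ F)
    (hnab : ∀ a ∈ F, nab a ∈ F) (hbox : ∀ a ∈ F, arr ⊤ a ∈ F) :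
    IsNablaCong nab arr (filterRel F) := by
  have common : ∀ {a b c d : A}, filterRel F a b → filterRel F c d →
      ∃ f ∈ F, a ⊓ f = b ⊓ f ∧ c ⊓ f = d ⊓ f := by
    rintro a b c d ⟨f, hf, hab⟩ ⟨g, hg, hcd⟩
    refine ⟨f ⊓ g, hinf f hf g hg, ?_, ?_⟩
    · rw [← inf_assoc, hab, inf_assoc]
    · rw [inf_comm f g, ← inf_assoc, hcd, inf_assoc]
  refine ⟨⟨fun a => ⟨⊤, htop, rfl⟩, fun ⟨f, hf, h⟩ => ⟨f, hf, h.symm⟩, fun hab hbc => ?_⟩,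
    fun a b c d hab hcd => ?_, fun a b c d hab hcd => ?_, ?_, fun a b c d hab hcd => ?_⟩
  · obtain ⟨f, hf, h₁, h₂⟩ := common hab hbc
    exact ⟨f, hf, h₁.trans h₂⟩
  · obtain ⟨f, hf, h₁, h₂⟩ := common hab hcd
    exact ⟨f, hf, by rw [inf_inf_distrib_right, h₁, h₂, ← inf_inf_distrib_right]⟩
  · obtain ⟨f, hf, h₁, h₂⟩ := common hab hcd
    exact ⟨f, hf, by rw [inf_sup_right, h₁, h₂, ← inf_sup_right]⟩
  · rintro a b ⟨f, hf, h⟩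
    exact ⟨nab f, hnab f hf, by rw [← ninf, h, ninf]⟩
  · obtain ⟨f, hf, h₁, h₂⟩ := common hab hcd
    exact ⟨arr ⊤ f, hbox f hf,
      (arr_mono_on_inf adj h₁ h₂).antisymm (arr_mono_on_inf adj h₁.symm h₂.symm)⟩

theorem le_box_iff (adj : ∀ a b c : A, nab c ⊓ a ≤ b ↔ c ≤ arr a b) (b c : A) :
    c ≤ arr ⊤ b ↔ nab c ≤ b := by
  rw [← adj, inf_top_eq]

theorem box_top (adj : ∀ a b c : A, nab c ⊓ a ≤ b ↔ c ≤ arr a b) : arr ⊤ ⊤ = (⊤ : A) :=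
  top_le_iff.1 ((le_box_iff adj _ _).2 le_top)

theorem box_inf (adj : ∀ a b c : A, nab c ⊓ a ≤ b ↔ c ≤ arr a b) (a b : A) :
    arr ⊤ (a ⊓ b) = arr ⊤ a ⊓ arr ⊤ b :=
  eq_of_forall_le_iff fun c => by simp only [le_inf_iff, le_box_iff adj]

theorem generatedFilter_inf {x a b : A} (ha : a ∈ generatedFilter nab arr x)
    (hb : b ∈ generatedFilter nab arr x) : a ⊓ b ∈ generatedFilter nab arr x := by
  classical
  obtain ⟨s, hs⟩ := ha
  obtain ⟨t, ht⟩ := hb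
  exact ⟨s ∪ t, Finset.inf_union.le.trans (inf_le_inf hs ht)⟩

theorem generatedFilter_nab (ntop : nab ⊤ = ⊤) (ninf : ∀ a b : A, nab (a ⊓ b) = nab a ⊓ nab b)
    {x a : A} (ha : a ∈ generatedFilter nab arr x) : nab a ∈ generatedFilter nab arr x := by
  classical
  obtain ⟨s, hs⟩ := ha
  refine ⟨s.image fun p => (p.1 + 1, p.2), ?_⟩
  have hmono : Monotone nab := Monotone.of_map_inf ninf
  refine le_trans (le_of_eq ?_) (hmono hs)
  rw [Finset.inf_image, Finset.apply_inf_eq_inf_comp nab ninf ntop]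
  refine Finset.inf_congr rfl fun p _ => ?_
  exact Function.iterate_succ_apply' nab _ _

theorem generatedFilter_box (adj : ∀ a b c : A, nab c ⊓ a ≤ b ↔ c ≤ arr a b)
    {x a : A} (ha : a ∈ generatedFilter nab arr x) : arr ⊤ a ∈ generatedFilter nab arr x := by
  classical
  obtain ⟨s, hs⟩ := ha
  refine ⟨s.image fun p => if p.1 = 0 then (0, p.2 + 1) else (p.1 - 1, p.2), ?_⟩
  have hmono : Monotone (arr ⊤) := Monotone.of_map_inf (box_inf adj)
  refine le_trans ?_ (hmono hs)
  rw [Finset.inf_image, Finset.apply_inf_eq_inf_comp (arr ⊤) (box_inf adj) (box_top adj)]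
  refine Finset.inf_mono_fun fun ⟨m, n⟩ _ => ?_
  cases m with
  | zero => exact (Function.iterate_succ_apply' (arr ⊤) n x).le
  | succ m =>
    refine (le_box_iff adj _ _).2 ?_
    exact (Function.iterate_succ_apply' nab m _).ge

end NablaAlgebra

/-- A normal distributive ∇-algebra is simple (its only
congruences are the identity and the full relation) iff for every `x ≠ ⊤`
there are finitely many iterates with `⨅ᵢ ∇^{mᵢ} □^{nᵢ} x = ⊥`.
Here `□ = arr ⊤`. -/
theorem simple_characterization {A : Type*}
    [DistribLattice A] [BoundedOrder A]
    (nab : A → A) (arr : A → A → A)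
    (adj : ∀ a b c : A, nab c ⊓ a ≤ b ↔ c ≤ arr a b)
    (ntop : nab ⊤ = ⊤) (ninf : ∀ a b : A, nab (a ⊓ b) = nab a ⊓ nab b) :
    (∀ θ : A → A → Prop, IsNablaCong nab arr θ →
      θ = (· = ·) ∨ θ = fun _ _ => True) ↔
    (∀ x : A, x ≠ ⊤ → ∃ (n : ℕ) (m k : Fin n → ℕ),
      (Finset.univ.inf fun i => nab^[m i] ((arr ⊤)^[k i] x)) = ⊥) := by
  constructor
  · intro simple x hx
    have hxF : x ∈ generatedFilter nab arr x := ⟨{(0, 0)}, by simp⟩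
    have hcong := isNablaCong_filterRel (F := generatedFilter nab arr x) adj ninf ⟨∅, le_top⟩
      (fun _ ha _ hb => generatedFilter_inf ha hb)
      (fun _ ha => generatedFilter_nab ntop ninf ha) (fun _ ha => generatedFilter_box adj ha)
    rcases simple _ hcong with h | h
    · have hrel : filterRel (generatedFilter nab arr x) x ⊤ := ⟨x, hxF, by simp⟩
      rw [h] at hrel
      exact absurd hrel hx
    · have hrel : filterRel (generatedFilter nab arr x) ⊥ ⊤ := h ▸ trivial
      obtain ⟨f, ⟨s, hs⟩, hf⟩ := hrel
      have hf : f = ⊥ := by simpa using hf.symm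
      refine ⟨s.card, fun i => (s.equivFin.symm i).1.1, fun i => (s.equivFin.symm i).1.2, ?_⟩
      refine le_bot_iff.1 (le_trans (Finset.le_inf fun p hp => ?_) (hs.trans hf.le))
      refine (Finset.inf_le (Finset.mem_univ (s.equivFin ⟨p, hp⟩))).trans ?_
      simp
  · rintro h θ ⟨heq, hinf, -, hnab, harr⟩
    refine or_iff_not_imp_left.2 fun hne => ?_
    obtain ⟨a, b, hab, hnle⟩ : ∃ a b, θ a b ∧ ¬ a ≤ b := by
      by_contra! hcon
      refine hne (funext fun a => funext fun b => propext ⟨fun hab => ?_, fun hab => ?_⟩)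
      · exact (hcon a b hab).antisymm (hcon b a (heq.symm hab))
      · exact hab ▸ heq.refl a
    have hbb : arr b b = ⊤ := top_le_iff.1 ((adj _ _ _).1 inf_le_right)
    have hx : θ (arr a b) ⊤ := hbb ▸ harr a b b b hab (heq.refl b)
    have hxne : arr a b ≠ ⊤ := fun he => hnle (by simpa [ntop] using (adj a b ⊤).2 he.ge)
    obtain ⟨n, m, k, hbot⟩ := h _ hxne
    have hbox : ∀ y, θ y ⊤ → θ (arr ⊤ y) ⊤ := fun y hy => by
      simpa only [box_top adj] using harr ⊤ ⊤ y ⊤ (heq.refl _) hy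
    have hnab' : ∀ y, θ y ⊤ → θ (nab y) ⊤ := fun y hy => by
      simpa only [ntop] using hnab y ⊤ hy
    have hiter : ∀ g : A → A, (∀ y, θ y ⊤ → θ (g y) ⊤) → ∀ j y, θ y ⊤ → θ (g^[j] y) ⊤ :=
      fun g hg j y hy => Function.Iterate.rec (fun z => θ z ⊤) hy hg j
    have hbt : θ ⊥ ⊤ := hbot ▸ Finset.inf_induction (p := fun z => θ z ⊤) (heq.refl _)
      (fun y hy z hz => by simpa using hinf y ⊤ z ⊤ hy hz)
      (fun i _ => hiter nab hnab' _ _ (hiter (arr ⊤) hbox _ _ hx))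
    have hall : ∀ y, θ ⊥ y := fun y => by simpa using hinf ⊥ ⊤ y y hbt (heq.refl y)
    exact funext fun y => funext fun z =>
      propext ⟨fun _ => trivial, fun _ => heq.trans (heq.symm (hall y)) (hall z)⟩
end

section
/- Let A be a ∇-algebra. For normal ideals M, N ⊆ A define M → N = { x ∈ A | ∀ m ∈ M, ∇x ⊓ m ∈ N } and ∇M = L(U(⋃_{m∈M} { y | y ≤ ∇m })). Then: (i) M → N is a normal ideal; (ii) for the principal ideals, ∇(a] = (∇a] and (a] → (b] = (a → b] for all a, b ∈ A; (iii) the adjunction holds on normal ideals: for all normal ideals M, N, K, ∇M ∩ N ⊆ K if and only if M ⊆ N → K. -/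
theorem monotone_of_inf_le_iff_le {A : Type*} [Lattice A] [BoundedOrder A]
    {nab : A → A} {arr : A → A → A}
    (adj : ∀ a b c : A, nab c ⊓ a ≤ b ↔ c ≤ arr a b) : Monotone nab := fun x y hxy => by
  have hy : y ≤ arr ⊤ (nab y) := (adj _ _ _).1 inf_le_left
  simpa using (adj _ _ _).2 (hxy.trans hy)

theorem mem_of_le_of_lowerBounds_upperBounds_eq {A : Type*} [Preorder A] {N : Set A}
    (hN : lowerBounds (upperBounds N) = N) {x y : A} (hxy : x ≤ y) (hy : y ∈ N) : x ∈ N := by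
  rw [← hN] at hy ⊢
  exact fun u hu => hxy.trans (hy hu)

/-- The Dedekind–MacNeille completion of a ∇-algebra. For
normal ideals `M, N` (subsets with `L(U(N)) = N`) define
`M → N = {x | ∀ m ∈ M, ∇x ⊓ m ∈ N}` and `∇M = L(U(⋃ m ∈ M, (∇m]))`. Then:
(i) `M → N` is a normal ideal; (ii) on principal ideals, `∇(a] = (∇a]` and
`(a] → (b] = (a → b]`; (iii) the adjunction `∇M ∩ N ⊆ K ↔ M ⊆ N → K` holds
for normal ideals. -/
theorem macneille_nabla_algebra {A : Type*} [Lattice A] [BoundedOrder A]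
    (nab : A → A) (arr : A → A → A)
    (adj : ∀ a b c : A, nab c ⊓ a ≤ b ↔ c ≤ arr a b) :
    -- (i)
    (∀ M N : Set A, lowerBounds (upperBounds M) = M →
      lowerBounds (upperBounds N) = N →
      lowerBounds (upperBounds {x : A | ∀ m ∈ M, nab x ⊓ m ∈ N}) =
        {x : A | ∀ m ∈ M, nab x ⊓ m ∈ N}) ∧
    -- (ii)
    (∀ a : A,
      lowerBounds (upperBounds (⋃ m ∈ {y : A | y ≤ a}, {y : A | y ≤ nab m})) =
        {y : A | y ≤ nab a}) ∧
    (∀ a b : A,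
      {x : A | ∀ m ∈ {y : A | y ≤ a}, nab x ⊓ m ∈ {y : A | y ≤ b}} =
        {y : A | y ≤ arr a b}) ∧
    -- (iii)
    (∀ M N K : Set A, lowerBounds (upperBounds M) = M →
      lowerBounds (upperBounds N) = N → lowerBounds (upperBounds K) = K →
      (lowerBounds (upperBounds (⋃ m ∈ M, {y : A | y ≤ nab m})) ∩ N ⊆ K ↔
        M ⊆ {x : A | ∀ m ∈ N, nab x ⊓ m ∈ K})) := by
  have mono := monotone_of_inf_le_iff_le adj
  refine ⟨fun M N _ hN => ?_, fun a => ?_, fun a b => ?_, fun M N K _ hN hK => ⟨?_, ?_⟩⟩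
  · refine Set.Subset.antisymm (fun x hx m hm => ?_) (subset_lowerBounds_upperBounds _)
    rw [← hN]
    exact fun u hu => (adj _ _ _).2 (hx fun s hs => (adj _ _ _).1 (hu (hs m hm)))
  · ext y
    refine ⟨fun hy => hy ?_, fun hy => subset_lowerBounds_upperBounds _ ?_⟩
    · intro z hz
      obtain ⟨m, hm, hz⟩ := Set.mem_iUnion₂.1 hz
      exact le_trans hz (mono hm)
    · exact Set.mem_iUnion₂.2 ⟨a, le_rfl, hy⟩
  · ext x
    exact ⟨fun hx => (adj _ _ _).1 (hx a le_rfl),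
      fun hx m hm => (inf_le_inf_left _ hm).trans ((adj _ _ _).2 hx)⟩
  · intro h x hx m hm
    exact h ⟨subset_lowerBounds_upperBounds _ (Set.mem_iUnion₂.2 ⟨x, hx, inf_le_left⟩),
      mem_of_le_of_lowerBounds_upperBounds_eq hN inf_le_right hm⟩
  · rintro h y ⟨hy, hyN⟩
    rw [← hK]
    intro u hu
    have hle : y ≤ nab (arr y u) := hy fun z hz => by
      obtain ⟨x, hx, hz⟩ := Set.mem_iUnion₂.1 hz
      exact le_trans hz (mono ((adj _ _ _).1 (hu (h hx y hyN))))
    exact (le_inf hle le_rfl).trans ((adj _ _ _).2 le_rfl)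
end

section
/- Let (W, ≤) be a poset, π : W → W a monotone map, and define the relation R by (x, y) ∈ R if and only if x ≤ π(y) (so (W, ≤, R) is a normal Kripke frame with normality witness π). Then: (i) R is reflexive if and only if w ≤ π(w) for all w ∈ W; (ii) R ⊆ ≤ if and only if π(w) ≤ w for all w ∈ W; (iii) the faithfulness condition — for every x ∈ W there exists y ∈ W with (y, x) ∈ R such that (y, z) ∈ R implies x ≤ z for all z — holds if and only if π is an order embedding (π(u) ≤ π(v) implies u ≤ v); (iv) the fullness condition — for every x ∈ W there exists y ∈ W with (x, y) ∈ R such that (z, y) ∈ R implies z ≤ x for all z — holds if and only if π is surjective. -/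
/-- For a poset `W` with monotone `π : W → W` and
`R = {(x, y) | x ≤ π y}` (a normal Kripke frame):
(i) `R` is reflexive iff `w ≤ π w` for all `w`;
(ii) `R ⊆ ≤` iff `π w ≤ w` for all `w`;
(iii) the faithfulness condition holds iff `π` is an order embedding;
(iv) the fullness condition holds iff `π` is surjective. -/
theorem normal_kripke_frame_conditions {W : Type*} [PartialOrder W]
    (π : W → W) (hπ : Monotone π) :
    (Reflexive (fun x y : W => x ≤ π y) ↔ ∀ w : W, w ≤ π w) ∧
    ((∀ x y : W, x ≤ π y → x ≤ y) ↔ ∀ w : W, π w ≤ w) ∧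
    ((∀ x : W, ∃ y : W, y ≤ π x ∧ ∀ z : W, y ≤ π z → x ≤ z) ↔
      (∀ u v : W, π u ≤ π v → u ≤ v)) ∧
    ((∀ x : W, ∃ y : W, x ≤ π y ∧ ∀ z : W, z ≤ π y → z ≤ x) ↔
      Function.Surjective π) := by
  refine ⟨Iff.rfl, ⟨fun h w => h (π w) w le_rfl, fun h x y hxy => hxy.trans (h y)⟩,
    ⟨fun h u v huv => ?_, fun h x => ⟨π x, le_rfl, fun z hz => h x z hz⟩⟩,
    ⟨fun h x => ?_, fun h x => ?_⟩⟩
  · obtain ⟨y, hy, hz⟩ := h u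
    exact hz v (hy.trans huv)
  · obtain ⟨y, hy, hz⟩ := h x
    exact ⟨y, le_antisymm (hz (π y) le_rfl) hy⟩
  · obtain ⟨y, rfl⟩ := h x
    exact ⟨y, le_rfl, fun z hz => hz⟩
end

section
/- Let (W_0, ≤_0, π_0), (W_1, ≤_1, π_1), (W_2, ≤_2, π_2) be normal Kripke frames (posets with monotone normality witnesses, the relation of each frame being R_i = {(x,y) | x ≤_i π_i(y)}), and let f : W_1 → W_0 and g : W_2 → W_0 be surjective Kripke morphisms. Then the fiber product W = { (y, z) ∈ W_1 × W_2 | f(y) = g(z) } with the componentwise order and the map π(y, z) = (π_1(y), π_2(z)) is a normal Kripke frame (in particular π maps W into W), the projections p : W → W_1 and q : W → W_2 are surjective Kripke morphisms, and f ∘ p = g ∘ q. Moreover, if both W_1 and W_2 satisfy any of the conditions (R): w ≤ π(w) for all w; (L): π(w) ≤ w for all w; (Fa): π is an order embedding — then W satisfies the same condition. -/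
/-- A Kripke morphism between normal Kripke frames `(W, ≤, π)` and
`(W', ≤', π')`: a monotone map `h` with `h ∘ π = π' ∘ h` and
`π'⁻¹(↑h(k)) = h[π⁻¹(↑k)]` for every `k`. -/
def IsKripkeMorphism {W W' : Type*} [PartialOrder W] [PartialOrder W']
    (π : W → W) (π' : W' → W') (h : W → W') : Prop :=
  Monotone h ∧ (∀ w : W, h (π w) = π' (h w)) ∧
    ∀ k : W, {l' : W' | h k ≤ π' l'} = h '' {l : W | k ≤ π l}

/-- If `f y = g z` and `z` sees `m`, then `y` sees some `l` lying over the same point as `m`. -/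
theorem IsKripkeMorphism.exists_lift {W0 W1 W2 : Type*}
    [PartialOrder W0] [PartialOrder W1] [PartialOrder W2]
    {π0 : W0 → W0} {π1 : W1 → W1} {π2 : W2 → W2} {f : W1 → W0} {g : W2 → W0}
    (hf : IsKripkeMorphism π1 π0 f) (hg : IsKripkeMorphism π2 π0 g)
    {y : W1} {z m : W2} (h : f y = g z) (hm : z ≤ π2 m) :
    ∃ l, y ≤ π1 l ∧ f l = g m := by
  have hR : g m ∈ {l' : W0 | f y ≤ π0 l'} := by
    rw [Set.mem_ofPred_eq, h, ← hg.2.1]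
    exact hg.1 hm
  rw [hf.2.2] at hR
  exact hR

/-- the fiber product of normal Kripke frames along surjective
Kripke morphisms is a normal Kripke frame; the projections are surjective
Kripke morphisms, the square commutes, and the conditions (R), (L), (Fa)
are inherited from the two factors. -/
theorem fiber_product_of_normal_kripke_frames
    {W0 W1 W2 : Type*} [PartialOrder W0] [PartialOrder W1] [PartialOrder W2]
    (π0 : W0 → W0) (π1 : W1 → W1) (π2 : W2 → W2)
    (hπ0 : Monotone π0) (hπ1 : Monotone π1) (hπ2 : Monotone π2)
    (f : W1 → W0) (g : W2 → W0)
    (hf : IsKripkeMorphism π1 π0 f) (hg : IsKripkeMorphism π2 π0 g)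
    (hfs : Function.Surjective f) (hgs : Function.Surjective g) :
    ∃ π : {w : W1 × W2 // f w.1 = g w.2} → {w : W1 × W2 // f w.1 = g w.2},
      -- π is the componentwise map (π₁, π₂); in particular it maps W into W
      (∀ w : {w : W1 × W2 // f w.1 = g w.2},
        (π w : W1 × W2) = (π1 (w : W1 × W2).1, π2 (w : W1 × W2).2)) ∧
      Monotone π ∧
      -- the projections are surjective Kripke morphisms
      IsKripkeMorphism π π1
        (fun w : {w : W1 × W2 // f w.1 = g w.2} => (w : W1 × W2).1) ∧
      IsKripkeMorphism π π2
        (fun w : {w : W1 × W2 // f w.1 = g w.2} => (w : W1 × W2).2) ∧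
      Function.Surjective
        (fun w : {w : W1 × W2 // f w.1 = g w.2} => (w : W1 × W2).1) ∧
      Function.Surjective
        (fun w : {w : W1 × W2 // f w.1 = g w.2} => (w : W1 × W2).2) ∧
      -- commutativity f ∘ p = g ∘ q
      (∀ w : {w : W1 × W2 // f w.1 = g w.2},
        f (w : W1 × W2).1 = g (w : W1 × W2).2) ∧
      -- (R)
      ((∀ w : W1, w ≤ π1 w) → (∀ w : W2, w ≤ π2 w) →
        ∀ w : {w : W1 × W2 // f w.1 = g w.2}, w ≤ π w) ∧
      -- (L)
      ((∀ w : W1, π1 w ≤ w) → (∀ w : W2, π2 w ≤ w) →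
        ∀ w : {w : W1 × W2 // f w.1 = g w.2}, π w ≤ w) ∧
      -- (Fa)
      ((∀ u v : W1, π1 u ≤ π1 v → u ≤ v) → (∀ u v : W2, π2 u ≤ π2 v → u ≤ v) →
        ∀ u v : {w : W1 × W2 // f w.1 = g w.2}, π u ≤ π v → u ≤ v) := by
  refine ⟨fun w => ⟨(π1 w.1.1, π2 w.1.2), by
    rw [hf.2.1, hg.2.1, w.2]⟩, fun _ => rfl,
    fun u v h => ⟨hπ1 h.1, hπ2 h.2⟩, ⟨fun u v h => h.1, fun _ => rfl, fun k => ?_⟩,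
    ⟨fun u v h => h.2, fun _ => rfl, fun k => ?_⟩, fun y => ?_, fun z => ?_, fun w => w.2,
    fun h1 h2 w => ⟨h1 _, h2 _⟩, fun h1 h2 w => ⟨h1 _, h2 _⟩,
    fun h1 h2 u v h => ⟨h1 _ _ h.1, h2 _ _ h.2⟩⟩
  · ext y
    refine ⟨fun hy => ?_, ?_⟩
    · obtain ⟨z, hz, hzy⟩ := hg.exists_lift hf k.2.symm hy
      exact ⟨⟨(y, z), hzy.symm⟩, ⟨hy, hz⟩, rfl⟩
    · rintro ⟨l, hl, rfl⟩
      exact hl.1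
  · ext z
    refine ⟨fun hz => ?_, ?_⟩
    · obtain ⟨y, hy, hyz⟩ := hf.exists_lift hg k.2 hz
      exact ⟨⟨(y, z), hyz⟩, ⟨hy, hz⟩, rfl⟩
    · rintro ⟨l, hl, rfl⟩
      exact hl.2
  · obtain ⟨z, hz⟩ := hgs (f y)
    exact ⟨⟨(y, z), hz.symm⟩, rfl⟩
  · obtain ⟨y, hy⟩ := hfs (g z)
    exact ⟨⟨(y, z), hy⟩, rfl⟩
end

section
/- The variety of normal distributive ∇-algebras has the amalgamation property: for any normal distributive ∇-algebras A_0, A_1, A_2 and any injective ∇-algebra morphisms f_1 : A_0 → A_1 and f_2 : A_0 → A_2, there exist a normal distributive ∇-algebra B and injective ∇-algebra morphisms g_1 : A_1 → B and g_2 : A_2 → B such that g_1 ∘ f_1 = g_2 ∘ f_2. -/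
universe u

/-- A normal distributive ∇-algebra: a bounded distributive lattice with
`nabla` and `arr` satisfying the adjunction `∇c ⊓ a ≤ b ↔ c ≤ a → b`,
where `∇` preserves finite meets. -/
structure NormalDistribNablaAlgebra : Type (u + 1) where
  carrier : Type u
  [lat : DistribLattice carrier]
  [bdd : BoundedOrder carrier]
  nabla : carrier → carrier
  arr : carrier → carrier → carrier
  adj : ∀ a b c : carrier, nabla c ⊓ a ≤ b ↔ c ≤ arr a b
  nabla_top : nabla ⊤ = ⊤
  nabla_inf : ∀ a b : carrier, nabla (a ⊓ b) = nabla a ⊓ nabla b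

attribute [instance] NormalDistribNablaAlgebra.lat NormalDistribNablaAlgebra.bdd

/-- A ∇-algebra morphism: preserves finite meets and joins, the bounds,
`∇` and `→`. -/
def IsNablaHom (A B : NormalDistribNablaAlgebra.{u})
    (h : A.carrier → B.carrier) : Prop :=
  h ⊤ = ⊤ ∧ h ⊥ = ⊥ ∧
    (∀ a b : A.carrier, h (a ⊓ b) = h a ⊓ h b) ∧
    (∀ a b : A.carrier, h (a ⊔ b) = h a ⊔ h b) ∧
    (∀ a : A.carrier, h (A.nabla a) = B.nabla (h a)) ∧
    (∀ a b : A.carrier, h (A.arr a b) = B.arr (h a) (h b))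

open Order in
/-- Prime separation in a distributive lattice: a down-directed family `F` none of whose members
lies below a member of an up-directed family `I` is separated from `I` by a point. -/
theorem exists_point_separating {L : Type u} [DistribLattice L] [BoundedOrder L] (F I : Set L)
    (hF : F.Nonempty) (hI : I.Nonempty)
    (hFinf : ∀ a ∈ F, ∀ b ∈ F, a ⊓ b ∈ F) (hIsup : ∀ a ∈ I, ∀ b ∈ I, a ⊔ b ∈ I)
    (hdisj : ∀ a ∈ F, ∀ b ∈ I, ¬ a ≤ b) :
    ∃ x : BoundedLatticeHom L Prop, (∀ a ∈ F, x a) ∧ ∀ b ∈ I, ¬ x b := by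
  have hF' : IsPFilter {a | ∃ b ∈ F, b ≤ a} := by
    refine IsPFilter.of_def ?_ ?_ ?_
    · obtain ⟨a, ha⟩ := hF
      exact ⟨a, a, ha, le_rfl⟩
    · rintro a ⟨a', ha', haa⟩ b ⟨b', hb', hbb⟩
      exact ⟨a' ⊓ b', ⟨_, hFinf _ ha' _ hb', le_rfl⟩,
        inf_le_left.trans haa, inf_le_right.trans hbb⟩
    · rintro a b hab ⟨c, hc, hca⟩
      exact ⟨c, hc, hca.trans hab⟩
  have hI' : IsIdeal {a | ∃ b ∈ I, a ≤ b} := by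
    refine ⟨?_, ?_, ?_⟩
    · rintro a b hab ⟨c, hc, hca⟩
      exact ⟨c, hc, hab.trans hca⟩
    · obtain ⟨a, ha⟩ := hI
      exact ⟨a, a, ha, le_rfl⟩
    · rintro a ⟨a', ha', haa⟩ b ⟨b', hb', hbb⟩
      exact ⟨a' ⊔ b', ⟨_, hIsup _ ha' _ hb', le_rfl⟩,
        haa.trans le_sup_left, hbb.trans le_sup_right⟩
  obtain ⟨J, hJ, hIJ, hFJ⟩ := DistribLattice.prime_ideal_of_disjoint_filter_ideal
    (F := hF'.toPFilter) (I := hI'.toIdeal) (by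
      refine Set.disjoint_left.2 ?_
      rintro a ⟨b, hb, hba⟩ ⟨c, hc, hac⟩
      exact hdisj b hb c hc (hba.trans hac))
  refine ⟨{ toFun := fun a => a ∉ J, map_sup' := ?_, map_inf' := ?_, map_top' := ?_,
            map_bot' := ?_ }, ?_, ?_⟩
  · intro a b
    simp only [Ideal.sup_mem_iff, sup_Prop_eq, eq_iff_iff]
    tauto
  · intro a b
    simp only [inf_Prop_eq, eq_iff_iff]
    refine ⟨fun h => ⟨fun ha => h (J.lower inf_le_left ha), fun hb => h (J.lower inf_le_right hb)⟩,
      fun h hab => ?_⟩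
    exact (hJ.mem_or_mem hab).elim h.1 h.2
  · exact eq_true hJ.top_notMem
  · exact eq_false (not_not.2 J.bot_mem)
  · intro a ha
    exact Set.disjoint_left.1 hFJ ⟨a, ha, le_rfl⟩
  · intro b hb
    exact not_not.2 (hIJ ⟨b, hb, le_rfl⟩)

/-- Every point of the domain of an embedding of distributive lattices extends to the codomain. -/
theorem exists_point_comp_eq {L M : Type u} [DistribLattice L] [BoundedOrder L]
    [DistribLattice M] [BoundedOrder M] (f : BoundedLatticeHom L M) (hf : Function.Injective f)
    (x : BoundedLatticeHom L Prop) : ∃ y : BoundedLatticeHom M Prop, y.comp f = x := by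
  obtain ⟨y, hy, hy'⟩ := exists_point_separating (f '' {a | x a}) (f '' {a | ¬ x a})
    ⟨f ⊤, ⊤, by simp, rfl⟩ ⟨f ⊥, ⊥, by simp, rfl⟩
    (by
      rintro _ ⟨a, ha, rfl⟩ _ ⟨b, hb, rfl⟩
      exact ⟨a ⊓ b, by simp_all, map_inf f a b⟩)
    (by
      rintro _ ⟨a, ha, rfl⟩ _ ⟨b, hb, rfl⟩
      exact ⟨a ⊔ b, by simp_all, map_sup f a b⟩)
    (by
      rintro _ ⟨a, ha, rfl⟩ _ ⟨b, hb, rfl⟩ hab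
      have hab' : a ≤ b := by
        rw [← inf_eq_left] at hab ⊢
        exact hf (by rw [map_inf, hab])
      exact hb (OrderHomClass.mono x hab' ha))
  refine ⟨y, BoundedLatticeHom.ext fun a => propext ⟨fun h => ?_, fun h => hy _ ⟨a, h, rfl⟩⟩⟩
  by_contra ha
  exact hy' _ ⟨a, ha, rfl⟩ h

namespace NormalDistribNablaAlgebra

/-- The points of a ∇-algebra: its prime filters, as homomorphisms to the two-element lattice. -/
abbrev Point (A : NormalDistribNablaAlgebra.{u}) : Type u := BoundedLatticeHom A.carrier Prop

/-- In a normal distributive ∇-algebra `∇` is a bounded lattice homomorphism. -/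
def nablaHom (A : NormalDistribNablaAlgebra.{u}) : BoundedLatticeHom A.carrier A.carrier where
  toFun := A.nabla
  map_sup' a b := by
    have gc : GaloisConnection A.nabla (A.arr ⊤) := fun c d => by simpa using A.adj ⊤ d c
    exact gc.l_sup
  map_inf' := A.nabla_inf
  map_top' := A.nabla_top
  map_bot' := by
    have gc : GaloisConnection A.nabla (A.arr ⊤) := fun c d => by simpa using A.adj ⊤ d c
    exact gc.l_bot

/-- The accessibility relation on points: `x` lies below the image of `y` under the dual
of `∇`. -/
def Point.Acc {A : NormalDistribNablaAlgebra.{u}} (x y : A.Point) : Prop :=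
  ∀ a, x a → y (A.nabla a)

theorem Point.Acc.of_arr {A : NormalDistribNablaAlgebra.{u}} {x y : A.Point} (h : x.Acc y)
    {a b : A.carrier} (hab : x (A.arr a b)) (ha : y a) : y b := by
  have hle : A.nabla (A.arr a b) ⊓ a ≤ b := (A.adj _ _ _).2 le_rfl
  refine OrderHomClass.mono y hle ?_
  rw [map_inf]
  exact ⟨h _ hab, ha⟩

theorem Point.exists_acc {A : NormalDistribNablaAlgebra.{u}} (x : A.Point) (S T : Set A.carrier)
    (hS : S.Nonempty) (hT : T.Nonempty)
    (hSinf : ∀ a ∈ S, ∀ b ∈ S, a ⊓ b ∈ S) (hTsup : ∀ a ∈ T, ∀ b ∈ T, a ⊔ b ∈ T)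
    (h : ∀ a ∈ S, ∀ b ∈ T, ¬ x (A.arr a b)) :
    ∃ y : A.Point, x.Acc y ∧ (∀ a ∈ S, y a) ∧ ∀ b ∈ T, ¬ y b := by
  obtain ⟨s, hs⟩ := hS
  obtain ⟨y, hy, hy'⟩ := exists_point_separating
    {c | ∃ p, x p ∧ ∃ a ∈ S, c = A.nabla p ⊓ a} T ⟨_, ⊤, by simp, s, hs, rfl⟩ hT
    (by
      rintro _ ⟨p, hp, a, ha, rfl⟩ _ ⟨q, hq, b, hb, rfl⟩
      refine ⟨p ⊓ q, by simp_all, a ⊓ b, hSinf _ ha _ hb, ?_⟩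
      rw [A.nabla_inf, inf_inf_inf_comm])
    hTsup
    (by
      rintro _ ⟨p, hp, a, ha, rfl⟩ b hb hle
      exact h a ha b hb (OrderHomClass.mono x ((A.adj _ _ _).1 hle) hp))
  refine ⟨y, fun p hp => ?_, fun a ha => ?_, hy'⟩
  · exact OrderHomClass.mono y inf_le_left (hy _ ⟨p, hp, s, hs, rfl⟩)
  · exact OrderHomClass.mono y inf_le_right (hy _ ⟨⊤, by simp, a, ha, rfl⟩)

/-- The complex algebra of a preorder with a monotone map: the lattice of lower sets,
with `∇` given by preimage. -/
def ofFrame (W : Type u) [Preorder W] (π : W →o W) : NormalDistribNablaAlgebra.{u} where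
  carrier := LowerSet W
  nabla U := ⟨π ⁻¹' U, fun _ _ h hx => U.lower (π.monotone h) hx⟩
  arr U V := ⟨{w | ∀ v, π v ≤ w → v ∈ U → v ∈ V}, fun _ _ h hx v hv => hx v (hv.trans h)⟩
  adj U V C := by
    refine ⟨fun h w hw v hv hU => h ⟨C.lower hv hw, hU⟩, ?_⟩
    rintro h v ⟨hC, hU⟩
    exact h hC v le_rfl hU
  nabla_top := rfl
  nabla_inf _ _ := rfl

section Representation

variable {A : NormalDistribNablaAlgebra.{u}} {W : Type u} [Preorder W]

/-- The map from a ∇-algebra to lower sets of a frame induced by an antitone map from the frame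
to the points. -/
def toLowerSet (p : W → A.Point) (hp : ∀ v w, v ≤ w → ∀ a, p w a → p v a) (a : A.carrier) : LowerSet W :=
  ⟨{w | p w a}, fun w v h ha => hp v w h a ha⟩

theorem isNablaHom_toLowerSet (π : W →o W) (p : W → A.Point) (hp : ∀ v w, v ≤ w → ∀ a, p w a → p v a)
    (hπ : ∀ w a, p (π w) a ↔ p w (A.nabla a))
    (hback : ∀ w y, (p w).Acc y → ∃ v, π v ≤ w ∧ p v = y) :
    IsNablaHom A (ofFrame W π) (toLowerSet p hp) := by
  refine ⟨?_, ?_, fun a b => ?_, fun a b => ?_, fun a => ?_, fun a b => ?_⟩ <;>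
    refine LowerSet.ext (Set.ext fun w => ?_)
  · exact iff_of_eq (map_top (p w))
  · exact iff_of_eq (map_bot (p w))
  · exact iff_of_eq (map_inf (p w) a b)
  · exact iff_of_eq (map_sup (p w) a b)
  · exact (hπ w a).symm
  · constructor
    · intro hw v hv ha
      exact Point.Acc.of_arr (fun c hc => (hπ v c).1 (hp _ _ hv c hc)) hw ha
    · intro hw
      by_contra hab
      obtain ⟨y, hy, hya, hyb⟩ := (p w).exists_acc {a} {b} ⟨a, rfl⟩ ⟨b, rfl⟩
        (by simp) (by simp) (by rintro _ rfl _ rfl; exact hab)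
      obtain ⟨v, hv, rfl⟩ := hback w y hy
      exact hyb b rfl (hw v hv (hya a rfl))

theorem toLowerSet_injective (p : W → A.Point) (hp : ∀ v w, v ≤ w → ∀ a, p w a → p v a)
    (hsurj : Function.Surjective p) : Function.Injective (toLowerSet p hp) := by
  have key : ∀ a b, toLowerSet p hp a = toLowerSet p hp b → a ≤ b := by
    intro a b hab
    by_contra hle
    obtain ⟨y, hy, hy'⟩ := exists_point_separating {a} {b} ⟨a, rfl⟩ ⟨b, rfl⟩
      (by simp) (by simp) (by rintro _ rfl _ rfl; exact hle)
    obtain ⟨w, rfl⟩ := hsurj y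
    have hw : w ∈ toLowerSet p hp a := hy a rfl
    rw [hab] at hw
    exact hy' b rfl hw
  exact fun a b hab => le_antisymm (key a b hab) (key b a hab.symm)

end Representation

end NormalDistribNablaAlgebra

namespace IsNablaHom

open NormalDistribNablaAlgebra

variable {A B C : NormalDistribNablaAlgebra.{u}}

/-- The bounded lattice homomorphism underlying a ∇-algebra morphism. -/
def toHom {f : A.carrier → B.carrier} (hf : IsNablaHom A B f) :
    BoundedLatticeHom A.carrier B.carrier where
  toFun := f
  map_sup' := hf.2.2.2.1
  map_inf' := hf.2.2.1
  map_top' := hf.1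
  map_bot' := hf.2.1

variable {f : A.carrier → B.carrier} {g : A.carrier → C.carrier}

/-- An accessibility step in one factor lifts to the other factor over the common subalgebra. -/
theorem exists_acc_of_acc (hf : IsNablaHom A B f) (hg : IsNablaHom A C g)
    {x y : B.Point} {z : C.Point} (hxz : ∀ a, x (f a) ↔ z (g a)) (hxy : x.Acc y) :
    ∃ w : C.Point, z.Acc w ∧ ∀ a, y (f a) ↔ w (g a) := by
  obtain ⟨w, hzw, hw, hw'⟩ := z.exists_acc (g '' {a | y (f a)}) (g '' {a | ¬ y (f a)})
    ⟨g ⊤, ⊤, by simp [hf.1], rfl⟩ ⟨g ⊥, ⊥, by simp [hf.2.1], rfl⟩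
    (by
      rintro _ ⟨a, ha, rfl⟩ _ ⟨b, hb, rfl⟩
      exact ⟨a ⊓ b, by simp_all [hf.2.2.1], hg.2.2.1 a b⟩)
    (by
      rintro _ ⟨a, ha, rfl⟩ _ ⟨b, hb, rfl⟩
      exact ⟨a ⊔ b, by simp_all [hf.2.2.2.1], hg.2.2.2.1 a b⟩)
    (by
      rintro _ ⟨a, ha, rfl⟩ _ ⟨b, hb, rfl⟩ hab
      rw [← hg.2.2.2.2.2, ← hxz, hf.2.2.2.2.2] at hab
      exact hb (hxy.of_arr hab ha))
  refine ⟨w, hzw, fun a => ⟨fun h => hw _ ⟨a, h, rfl⟩, fun h => ?_⟩⟩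
  by_contra ha
  exact hw' _ ⟨a, ha, rfl⟩ h

theorem exists_compatible_point (hf : IsNablaHom A B f) (hg : IsNablaHom A C g)
    (hinj : Function.Injective g) (x : B.Point) : ∃ z : C.Point, ∀ a, x (f a) ↔ z (g a) := by
  obtain ⟨z, hz⟩ := exists_point_comp_eq hg.toHom hinj (x.comp hf.toHom)
  exact ⟨z, fun a => iff_of_eq (DFunLike.congr_fun hz a).symm⟩

variable (f g) in
/-- The pullback of the spaces of points of `B` and `C` over that of `A`. -/
def PointPullback : Type u := {x : B.Point × C.Point // ∀ a, x.1 (f a) ↔ x.2 (g a)}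

instance : Preorder (PointPullback f g) where
  le x y := (∀ b, y.1.1 b → x.1.1 b) ∧ ∀ c, y.1.2 c → x.1.2 c
  le_refl _ := ⟨fun _ => id, fun _ => id⟩
  le_trans _ _ _ h k := ⟨fun b => h.1 b ∘ k.1 b, fun c => h.2 c ∘ k.2 c⟩

/-- The map on the pullback dual to `∇` in both factors. -/
noncomputable def PointPullback.shift (hf : IsNablaHom A B f) (hg : IsNablaHom A C g) :
    PointPullback f g →o PointPullback f g where
  toFun x := ⟨(x.1.1.comp B.nablaHom, x.1.2.comp C.nablaHom), fun a => by
    change x.1.1 (B.nabla (f a)) ↔ x.1.2 (C.nabla (g a))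
    rw [← hf.2.2.2.2.1, ← hg.2.2.2.2.1]
    exact x.2 _⟩
  monotone' _ _ h := ⟨fun a => h.1 (B.nabla a), fun a => h.2 (C.nabla a)⟩

end IsNablaHom

open IsNablaHom NormalDistribNablaAlgebra

/-- The variety of normal distributive ∇-algebras has the
amalgamation property. -/
theorem normal_distrib_nabla_amalgamation
    (A0 A1 A2 : NormalDistribNablaAlgebra.{u})
    (f1 : A0.carrier → A1.carrier) (f2 : A0.carrier → A2.carrier)
    (hf1 : IsNablaHom A0 A1 f1) (hf2 : IsNablaHom A0 A2 f2)
    (inj1 : Function.Injective f1) (inj2 : Function.Injective f2) :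
    ∃ (B : NormalDistribNablaAlgebra.{u})
      (g1 : A1.carrier → B.carrier) (g2 : A2.carrier → B.carrier),
      IsNablaHom A1 B g1 ∧ IsNablaHom A2 B g2 ∧
      Function.Injective g1 ∧ Function.Injective g2 ∧
      g1 ∘ f1 = g2 ∘ f2 := by
  let π := PointPullback.shift hf1 hf2
  let p1 : PointPullback f1 f2 → A1.Point := fun x => x.1.1
  let p2 : PointPullback f1 f2 → A2.Point := fun x => x.1.2
  have hp1 : ∀ v w, v ≤ w → ∀ a, p1 w a → p1 v a := fun _ _ h => h.1
  have hp2 : ∀ v w, v ≤ w → ∀ a, p2 w a → p2 v a := fun _ _ h => h.2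
  refine ⟨ofFrame (PointPullback f1 f2) π, toLowerSet p1 hp1, toLowerSet p2 hp2,
    isNablaHom_toLowerSet π p1 hp1 (fun _ _ => Iff.rfl) fun w y hy => ?_,
    isNablaHom_toLowerSet π p2 hp2 (fun _ _ => Iff.rfl) fun w y hy => ?_,
    toLowerSet_injective p1 hp1 fun x => ?_, toLowerSet_injective p2 hp2 fun x => ?_,
    funext fun a => LowerSet.ext (Set.ext fun w => w.2 a)⟩
  · obtain ⟨z, hz, hyz⟩ := exists_acc_of_acc hf1 hf2 w.2 hy
    exact ⟨⟨(y, z), hyz⟩, ⟨hy, hz⟩, rfl⟩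
  · obtain ⟨z, hz, hyz⟩ := exists_acc_of_acc hf2 hf1 (fun a => (w.2 a).symm) hy
    exact ⟨⟨(z, y), fun a => (hyz a).symm⟩, ⟨hz, hy⟩, rfl⟩
  · obtain ⟨z, hz⟩ := exists_compatible_point hf1 hf2 inj2 x
    exact ⟨⟨(x, z), hz⟩, rfl⟩
  · obtain ⟨z, hz⟩ := exists_compatible_point hf2 hf1 inj1 x
    exact ⟨⟨(z, x), fun a => (hz a).symm⟩, rfl⟩
end
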